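/- (Theorem 4.1, square truncations) Suppose A is block-tridiagonal, i.e. A equals its tridiagonal part B (so C = 0), and write A_{n,k} := B_{n,k}. Then, for every n with 2 < n ≤ N−1: min_{0≤k≤N−n} ν(A_{n,k}) ≤ ν(A) + ε_{n−2}(A). -/

import Mathlib

open scoped Real

noncomputable section

namespace SpecIncl

/-- The smallest singular value of a (possibly rectangular) complex matrix,
as the infimum of `‖F x‖` over the unit sphere. -/
noncomputable def sval {ι κ : Type*} [Fintype ι] [Fintype κ] [DecidableEq κ]
    (F : Matrix ι κ ℂ) : ℝ :=
  sInf {y : ℝ | ∃ x : EuclideanSpace ℂ κ, ‖x‖ = 1 ∧ y = ‖Matrix.toEuclideanLin F x‖}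

/-- The spectral norm (2-norm) of a complex matrix. -/
noncomputable def opNorm {ι κ : Type*} [Fintype ι] [Fintype κ] [DecidableEq κ]
    (F : Matrix ι κ ℂ) : ℝ :=
  sSup {y : ℝ | ∃ x : EuclideanSpace ℂ κ, ‖x‖ = 1 ∧ y = ‖Matrix.toEuclideanLin F x‖}

/-- The closed ε-pseudospectrum of a square complex matrix. -/
noncomputable def pspec {ι : Type*} [Fintype ι] [DecidableEq ι] (ε : ℝ)
    (E : Matrix ι ι ℂ) : Set ℂ :=
  {z : ℂ | sval (E - z • (1 : Matrix ι ι ℂ)) ≤ ε}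

/-- Assemble blocks into a block matrix indexed by a sigma type. -/
def blockMat {N : ℕ} (m : Fin N → ℕ)
    (a : ∀ i j : Fin N, Matrix (Fin (m i)) (Fin (m j)) ℂ) :
    Matrix ((i : Fin N) × Fin (m i)) ((j : Fin N) × Fin (m j)) ℂ :=
  fun p q => a p.1 q.1 p.2 q.2

/-- The block-tridiagonal part of a block matrix. -/
def triPart {N : ℕ} {m : Fin N → ℕ}
    (a : ∀ i j : Fin N, Matrix (Fin (m i)) (Fin (m j)) ℂ) :
    ∀ i j : Fin N, Matrix (Fin (m i)) (Fin (m j)) ℂ :=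
  fun i j => if |(i : ℤ) - (j : ℤ)| ≤ 1 then a i j else 0

/-- The remaining (off-tridiagonal) part of a block matrix. -/
def remPart {N : ℕ} {m : Fin N → ℕ}
    (a : ∀ i j : Fin N, Matrix (Fin (m i)) (Fin (m j)) ℂ) :
    ∀ i j : Fin N, Matrix (Fin (m i)) (Fin (m j)) ℂ :=
  fun i j => if |(i : ℤ) - (j : ℤ)| ≤ 1 then 0 else a i j

/-- r_L(A): max of the norms of the first-subdiagonal blocks. -/
noncomputable def rL {N : ℕ} {m : Fin N → ℕ}
    (a : ∀ i j : Fin N, Matrix (Fin (m i)) (Fin (m j)) ℂ) : ℝ :=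
  sSup {y : ℝ | ∃ i j : Fin N, (j : ℕ) + 1 = (i : ℕ) ∧ y = opNorm (a i j)}

/-- r_U(A): max of the norms of the first-superdiagonal blocks. -/
noncomputable def rU {N : ℕ} {m : Fin N → ℕ}
    (a : ∀ i j : Fin N, Matrix (Fin (m i)) (Fin (m j)) ℂ) : ℝ :=
  sSup {y : ℝ | ∃ i j : Fin N, (i : ℕ) + 1 = (j : ℕ) ∧ y = opNorm (a i j)}

noncomputable def rA {N : ℕ} {m : Fin N → ℕ}
    (a : ∀ i j : Fin N, Matrix (Fin (m i)) (Fin (m j)) ℂ) : ℝ :=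
  rL a + rU a

/-- θ_n for the coefficient `c = r_L r_U / r²`: the unique solution of
`2 sin(t/2) cos((n+1/2)t) + c sin((n−1)t) = 0` in `[π/(2n+1), π/(n+2)]`
(by uniqueness, equal to the infimum of the solution set). -/
noncomputable def theta (c : ℝ) (n : ℕ) : ℝ :=
  sInf {t : ℝ | t ∈ Set.Icc (Real.pi / (2 * (n : ℝ) + 1)) (Real.pi / ((n : ℝ) + 2)) ∧
    2 * Real.sin (t / 2) * Real.cos (((n : ℝ) + 1 / 2) * t)
      + c * Real.sin (((n : ℝ) - 1) * t) = 0}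

/-- ε_n(A) := 2 r(A) sin(θ_n(A)/2) + ‖C‖. -/
noncomputable def epsTau {N : ℕ} {m : Fin N → ℕ}
    (a : ∀ i j : Fin N, Matrix (Fin (m i)) (Fin (m j)) ℂ) (n : ℕ) : ℝ :=
  2 * rA a * Real.sin (theta (rL a * rU a / (rA a) ^ 2) n / 2)
    + opNorm (blockMat m (remPart a))

/-- The index `k + i` in `Fin N` (0-based window of length `n` starting at `k`). -/
def widx {N n k : ℕ} (h : k + n ≤ N) (i : Fin n) : Fin N :=
  ⟨k + i, by have := i.isLt; omega⟩

/-- The principal submatrix `B_{n,k}` of a block matrix, with block rows and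
columns `k+1,…,k+n` (1-based), i.e. `k,…,k+n-1` (0-based). -/
def window {N : ℕ} {m : Fin N → ℕ}
    (b : ∀ i j : Fin N, Matrix (Fin (m i)) (Fin (m j)) ℂ)
    (n k : ℕ) (h : k + n ≤ N) :
    Matrix ((i : Fin n) × Fin (m (widx h i))) ((j : Fin n) × Fin (m (widx h j))) ℂ :=
  fun p q => b (widx h p.1) (widx h q.1) p.2 q.2

/-- σ^n_ε(A) of the τ-method. -/
noncomputable def sigmaLow {N : ℕ} {m : Fin N → ℕ}
    (a : ∀ i j : Fin N, Matrix (Fin (m i)) (Fin (m j)) ℂ)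
    (n : ℕ) (h : n ≤ N) (ε : ℝ) : Set ℂ :=
  (⋃ k : Fin (N - n + 1),
      pspec (ε + epsTau a n)
        (window (triPart a) n k (by have := k.isLt; omega))) ∪
  (⋃ m' : Fin (n - 1),
      pspec (ε + epsTau a n)
        (window (triPart a) (m' + 1) 0 (by have := m'.isLt; omega)) ∪
      pspec (ε + epsTau a n)
        (window (triPart a) (m' + 1) (N - (m' + 1)) (by have := m'.isLt; omega)))

/-- σ̂^n_ε(A) of the τ-method. -/
noncomputable def sigmaHat {N : ℕ} {m : Fin N → ℕ}
    (a : ∀ i j : Fin N, Matrix (Fin (m i)) (Fin (m j)) ℂ)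
    (n : ℕ) (h : n ≤ N) (ε : ℝ) : Set ℂ :=
  ⋃ k : Fin (N - n + 1),
    pspec (ε + epsTau a (n - 2))
      (window (triPart a) n k (by have := k.isLt; omega))

/-- The τ-method inclusion set Σ^n_ε(A). -/
noncomputable def SigmaTau {N : ℕ} {m : Fin N → ℕ}
    (a : ∀ i j : Fin N, Matrix (Fin (m i)) (Fin (m j)) ℂ)
    (n : ℕ) (h : n ≤ N) (ε : ℝ) : Set ℂ :=
  if n ≤ 2 then sigmaLow a n h ε else sigmaLow a n h ε ∩ sigmaHat a n h ε

end SpecIncl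

namespace SpecIncl

section

lemma sum_sq_sin_half {t : ℝ} (ht : Real.sin t ≠ 0) (j : ℕ) :
    ∑ q ∈ Finset.range j, Real.sin ((q + 1 / 2) * t) ^ 2
      = j / 2 - Real.sin (2 * j * t) / (4 * Real.sin t) := by
  induction j with
  | zero => simp
  | succ j ih =>
    rw [Finset.sum_range_succ, ih]
    have h1 : Real.sin (2 * ((j + 1 : ℕ) : ℝ) * t)
        = Real.sin (2 * j * t) + 2 * Real.sin t * Real.cos (2 * ((j + 1 / 2) * t)) := by
      have e1 : 2 * ((j + 1 : ℕ) : ℝ) * t = 2 * ((j + 1 / 2) * t) + t := by push_cast; ring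
      have e2 : 2 * (j : ℝ) * t = 2 * ((j + 1 / 2) * t) - t := by ring
      rw [e1, e2, Real.sin_add, Real.sin_sub]; ring
    rw [h1, Real.cos_two_mul, Real.cos_sq']
    push_cast
    field_simp
    ring

/-- The increments of the sequence `sin ((q + 1/2) t)`, started from zero. -/
lemma sin_half_sub (x t : ℝ) :
    Real.sin (x + t / 2) - Real.sin (x - t / 2) = 2 * Real.sin (t / 2) * Real.cos x := by
  rw [Real.sin_add, Real.sin_sub]; ring

lemma sum_sq_cos_mul {t : ℝ} (ht : Real.sin t ≠ 0) (j : ℕ) :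
    Real.sin (t / 2) ^ 2 + ∑ q ∈ Finset.range j, (2 * Real.sin (t / 2) * Real.cos ((q + 1) * t)) ^ 2
      = 2 * Real.sin (t / 2) ^ 2 * j
        + Real.sin (t / 2) ^ 2 * Real.sin ((2 * j + 1) * t) / Real.sin t := by
  induction j with
  | zero => simp; field_simp
  | succ j ih =>
    rw [Finset.sum_range_succ, ← add_assoc, ih]
    have h1 : Real.sin ((2 * ((j + 1 : ℕ) : ℝ) + 1) * t)
        = Real.sin ((2 * j + 1) * t) + 2 * Real.sin t * Real.cos (2 * ((j + 1) * t)) := by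
      have e1 : (2 * ((j + 1 : ℕ) : ℝ) + 1) * t = 2 * ((j + 1) * t) + t := by push_cast; ring
      have e2 : (2 * (j : ℝ) + 1) * t = 2 * ((j + 1) * t) - t := by ring
      rw [e1, e2, Real.sin_add, Real.sin_sub]; ring
    rw [h1, Real.cos_two_mul]
    push_cast
    field_simp
    ring

section Critical

variable {ρL ρU t x : ℝ}

lemma critical_diff_nonneg (hL : 1 / 2 ≤ ρL) (hU : 0 ≤ ρU) (hs : ρL + ρU = 1)
    (ht0 : 0 < t) (ht : t ≤ π / 3) (hx0 : 2 * t ≤ x) (hx1 : x + t ≤ π)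
    (heq : Real.sin x - Real.sin (x - t) + ρL * ρU * Real.sin (x - 2 * t) = 0) :
    0 ≤ Real.sin (x - t) - ρL * Real.sin (x - 2 * t) := by
  have hh : 0 < Real.sin (t / 2) := Real.sin_pos_of_pos_of_lt_pi (by linarith) (by linarith)
  have e1 := sin_half_sub (x - t / 2) t
  have e2 := sin_half_sub (x - t / 2 - t) t
  rw [show x - t / 2 + t / 2 = x by ring, show x - t / 2 - t / 2 = x - t by ring] at e1
  rw [show x - t / 2 - t + t / 2 = x - t by ring,
    show x - t / 2 - t - t / 2 = x - 2 * t by ring] at e2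
  have hsn : 0 ≤ Real.sin (x - 2 * t) :=
    Real.sin_nonneg_of_nonneg_of_le_pi (by linarith) (by linarith)
  have hc : 0 ≤ ρL * ρU * Real.sin (x - 2 * t) := by positivity
  have hcos : Real.cos (x - t / 2) ≤ 0 := by
    by_contra hcon
    push Not at hcon
    have := mul_pos (mul_pos two_pos hh) hcon
    linarith
  have hmono : Real.cos (x - t / 2) ≤ Real.cos (x - t / 2 - t) :=
    Real.cos_le_cos_of_nonneg_of_le_pi (by linarith) (by linarith) (by linarith)
  have hkey : Real.cos (x - t / 2) ≤ ρL * Real.cos (x - t / 2 - t) := by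
    rcases le_total 0 (Real.cos (x - t / 2 - t)) with h | h
    · have : 0 ≤ ρL * Real.cos (x - t / 2 - t) := mul_nonneg (by linarith) h
      linarith
    · nlinarith
  have h3 := mul_nonneg hh.le (sub_nonneg.2 hkey)
  have h4 : 0 ≤ ρL * (Real.sin (x - t) - ρL * Real.sin (x - 2 * t)) := by
    have hu : ρU = 1 - ρL := by linarith
    subst hu
    nlinarith
  exact nonneg_of_mul_nonneg_right h4 (by linarith)

lemma critical_recurrence (hs : ρL + ρU = 1)
    (heq : Real.sin x - Real.sin (x - t) + ρL * ρU * Real.sin (x - 2 * t) = 0) :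
    Real.sin (x + t) - ρL * Real.sin x
        = (2 * ρU * Real.cos t - 1) * (Real.sin (x - t) - ρL * Real.sin (x - 2 * t))
      ∧ Real.sin x - ρL * Real.sin (x - t)
        = ρU * (Real.sin (x - t) - ρL * Real.sin (x - 2 * t)) := by
  have hu : ρL = 1 - ρU := by linarith
  have a1 : Real.sin (x + t) + Real.sin (x - t) = 2 * Real.cos t * Real.sin x := by
    rw [Real.sin_add, Real.sin_sub]; ring
  have a2 : Real.sin x + Real.sin (x - 2 * t) = 2 * Real.cos t * Real.sin (x - t) := by
    have := Real.sin_add (x - t) t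
    have h2 := Real.sin_sub (x - t) t
    rw [show x - t + t = x by ring] at this
    rw [show x - t - t = x - 2 * t by ring] at h2
    rw [this, h2]; ring
  subst hu
  constructor
  · have : Real.sin (x + t) = 2 * Real.cos t * Real.sin x - Real.sin (x - t) := by linarith
    rw [this]
    linear_combination (-(1 - ρU)) * a2 + 2 * Real.cos t * heq
  · linear_combination heq

lemma critical_sin_le (hL : 1 / 2 ≤ ρL) (hU : 0 ≤ ρU) (hs : ρL + ρU = 1)
    (ht0 : 0 < t) (ht : t ≤ π / 3) (hx0 : 2 * t ≤ x) (hx1 : x + t ≤ π)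
    (heq : Real.sin x - Real.sin (x - t) + ρL * ρU * Real.sin (x - 2 * t) = 0) :
    Real.sin (x + t) ≤ ρL * Real.sin x := by
  have h1 := critical_diff_nonneg hL hU hs ht0 ht hx0 hx1 heq
  have h2 := (critical_recurrence hs heq).1
  have h3 : 2 * ρU * Real.cos t - 1 ≤ 0 := by
    nlinarith [Real.cos_le_one t]
  nlinarith [mul_nonneg h1 (neg_nonneg.2 h3)]

lemma critical_sin_half_le (hL : 1 / 2 ≤ ρL) (hU : 0 ≤ ρU) (hs : ρL + ρU = 1)
    (ht0 : 0 < t) (ht : t ≤ π / 3) (hx0 : 2 * t ≤ x) (hx1 : x + t ≤ π)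
    (heq : Real.sin x - Real.sin (x - t) + ρL * ρU * Real.sin (x - 2 * t) = 0) :
    Real.sin (x + 3 * t / 2) ≤ ρL * Real.sin (x + t / 2) := by
  have h1 := critical_sin_le hL hU hs ht0 ht hx0 hx1 heq
  have hx : 0 < Real.sin x := Real.sin_pos_of_pos_of_lt_pi (by linarith) (by linarith)
  have hw : 0 ≤ Real.sin (x + t / 2) :=
    Real.sin_nonneg_of_nonneg_of_le_pi (by linarith) (by linarith)
  have h2 : Real.sin (x + 3 * t / 2) * Real.sin x ≤ Real.sin (x + t / 2) * Real.sin (x + t) := by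
    have c1 : Real.cos (3 * t / 2) ≤ Real.cos (t / 2) :=
      Real.cos_le_cos_of_nonneg_of_le_pi (by linarith) (by linarith) (by linarith)
    have e1 : 2 * (Real.sin (x + 3 * t / 2) * Real.sin x)
        = Real.cos (3 * t / 2) - Real.cos (2 * x + 3 * t / 2) := by
      have := Real.two_mul_sin_mul_sin (x + 3 * t / 2) x
      rw [show x + 3 * t / 2 - x = 3 * t / 2 by ring,
        show x + 3 * t / 2 + x = 2 * x + 3 * t / 2 by ring] at this
      linarith
    have e2 : 2 * (Real.sin (x + t) * Real.sin (x + t / 2))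
        = Real.cos (t / 2) - Real.cos (2 * x + 3 * t / 2) := by
      have := Real.two_mul_sin_mul_sin (x + t) (x + t / 2)
      rw [show x + t - (x + t / 2) = t / 2 by ring,
        show x + t + (x + t / 2) = 2 * x + 3 * t / 2 by ring] at this
      linarith
    linarith
  have h3 := mul_le_mul_of_nonneg_left h1 hw
  have h4 : Real.sin (x + 3 * t / 2) * Real.sin x
      ≤ (ρL * Real.sin (x + t / 2)) * Real.sin x := by linarith
  exact le_of_mul_le_mul_right h4 hx

end Critical

end

section

/-- The sequence `sin ((q + 1/2) t)`, cut off to zero from `n` on. -/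
def halfSine (t : ℝ) (n q : ℕ) : ℝ := if q < n then Real.sin ((q + 1 / 2) * t) else 0

/-- The increments of `halfSine`, with initial value zero. -/
def halfSineStep (t : ℝ) (n q : ℕ) : ℝ :=
  if q = 0 then halfSine t n 0 else halfSine t n q - halfSine t n (q - 1)

section HalfSine

variable {t : ℝ} {n : ℕ}

lemma sum_halfSine_sq (ht : Real.sin t ≠ 0) {j : ℕ} (hj : j ≤ n) :
    ∑ q ∈ Finset.range j, halfSine t n q ^ 2
      = j / 2 - Real.sin (2 * j * t) / (4 * Real.sin t) := by
  rw [← sum_sq_sin_half ht]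
  refine Finset.sum_congr rfl fun q hq => ?_
  have : q < n := (Finset.mem_range.1 hq).trans_le hj
  simp [halfSine, this]

lemma sum_halfSine_sq_of_le {j : ℕ} (hj : n ≤ j) :
    ∑ q ∈ Finset.range j, halfSine t n q ^ 2 = ∑ q ∈ Finset.range n, halfSine t n q ^ 2 := by
  symm
  refine Finset.sum_subset (Finset.range_mono hj) fun q _ hq => ?_
  have : ¬ q < n := by simpa using hq
  simp [halfSine, this]

lemma halfSineStep_succ {q : ℕ} (hq : q + 1 < n) :
    halfSineStep t n (q + 1) = 2 * Real.sin (t / 2) * Real.cos ((q + 1) * t) := by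
  have := sin_half_sub ((q + 1) * t) t
  rw [← this]
  simp only [halfSineStep, halfSine, hq, Nat.lt_of_succ_lt hq, if_true, Nat.add_sub_cancel,
    Nat.succ_ne_zero, if_false]
  push_cast
  congr 2 <;> ring

lemma sum_halfSineStep_sq (ht : Real.sin t ≠ 0) {j : ℕ} (hj : j < n) :
    ∑ q ∈ Finset.range (j + 1), halfSineStep t n q ^ 2
      = 2 * Real.sin (t / 2) ^ 2 * j
        + Real.sin (t / 2) ^ 2 * Real.sin ((2 * j + 1) * t) / Real.sin t := by
  rw [← sum_sq_cos_mul ht, Finset.sum_range_succ', add_comm]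
  congr 1
  · have : 0 < n := by omega
    simp only [halfSineStep, halfSine, this, if_true]
    push_cast
    congr 2; ring
  · refine Finset.sum_congr rfl fun q hq => ?_
    rw [halfSineStep_succ (by have := Finset.mem_range.1 hq; omega)]

lemma sum_halfSineStep_sq_of_le (hn : 0 < n) {j : ℕ} (hj : n ≤ j) :
    ∑ q ∈ Finset.range (j + 1), halfSineStep t n q ^ 2
      = ∑ q ∈ Finset.range n, halfSineStep t n q ^ 2 + Real.sin ((n - 1 / 2) * t) ^ 2 := by
  have h1 : ∑ q ∈ Finset.range (j + 1), halfSineStep t n q ^ 2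
      = ∑ q ∈ Finset.range (n + 1), halfSineStep t n q ^ 2 := by
    symm
    refine Finset.sum_subset (Finset.range_mono (by omega)) fun q _ hq => ?_
    have hq' : n + 1 ≤ q := by simpa using hq
    have h1 : ¬ q < n := by omega
    have h2 : ¬ q - 1 < n := by omega
    have h3 : q ≠ 0 := by omega
    simp [halfSineStep, halfSine, h1, h2, h3]
  rw [h1, Finset.sum_range_succ]
  congr 1
  obtain ⟨p, rfl⟩ : ∃ p, n = p + 1 := ⟨n - 1, by omega⟩
  simp only [halfSineStep, halfSine]
  simp
  congr 2; ring

/-- The gap between `Λ ∑ w²` and `∑ (Δw)²` for the half-integer sine sequence. -/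
lemma sum_halfSine_gap (ht0 : 0 < t) (ht : t < π) (hn : 0 < n) :
    ∑ q ∈ Finset.range n, halfSineStep t n q ^ 2
      = 4 * Real.sin (t / 2) ^ 2 * ∑ q ∈ Finset.range n, halfSine t n q ^ 2
        - Real.sin (t / 2) ^ 2
        - Real.sin ((n - 1 / 2) * t)
          * (Real.sin ((n - 1 / 2) * t) - Real.sin ((n + 1 / 2) * t)) := by
  have hs : 0 < Real.sin t := Real.sin_pos_of_pos_of_lt_pi ht0 ht
  obtain ⟨p, rfl⟩ : ∃ p, n = p + 1 := ⟨n - 1, by omega⟩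
  rw [sum_halfSine_sq hs.ne' le_rfl, sum_halfSineStep_sq hs.ne' (Nat.lt_succ_self p)]
  push_cast
  have e0 := sin_half_sub ((p + 1) * t) t
  have a1 : ((p : ℝ) + 1 - 1 / 2) * t = (p + 1) * t - t / 2 := by ring
  have a2 : ((p : ℝ) + 1 + 1 / 2) * t = (p + 1) * t + t / 2 := by ring
  have a3 : (2 * (p : ℝ) + 1) * t = 2 * ((p + 1) * t) - t := by ring
  have a4 : 2 * ((p : ℝ) + 1) * t = 2 * ((p + 1) * t) := by ring
  rw [a1, a2, a3, a4]
  set y := ((p : ℝ) + 1) * t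
  have hst : Real.sin t = 2 * Real.sin (t / 2) * Real.cos (t / 2) := by
    rw [← Real.sin_two_mul]; ring_nf
  have hct : Real.cos t = 2 * Real.cos (t / 2) ^ 2 - 1 := by
    rw [← Real.cos_two_mul]; ring_nf
  have hh : 0 < Real.sin (t / 2) := Real.sin_pos_of_pos_of_lt_pi (by linarith) (by linarith)
  have hk : 0 < Real.cos (t / 2) :=
    Real.cos_pos_of_mem_Ioo ⟨by linarith, by linarith⟩
  rw [Real.sin_sub (2 * y) t, Real.sin_two_mul y, Real.cos_two_mul y, Real.sin_sub y,
    Real.sin_add y, hct, hst]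
  generalize Real.sin (t / 2) = h at *
  generalize Real.cos (t / 2) = k at *
  generalize Real.sin y = s at *
  generalize Real.cos y = c at *
  have hne : h ≠ 0 := hh.ne'
  have kne : k ≠ 0 := hk.ne'
  field_simp
  ring_nf

lemma sum_halfSineStep_add_le {ρL ρU : ℝ} (hs : ρL + ρU = 1) (ht0 : 0 < t)
    (ht : t ≤ π / 3) (hn : 0 < n) (hnt : n * t ≤ π)
    (hw : Real.sin ((n + 1 / 2) * t) ≤ ρL * Real.sin ((n - 1 / 2) * t)) :
    ∑ q ∈ Finset.range n, halfSineStep t n q ^ 2 + ρU * Real.sin ((n - 1 / 2) * t) ^ 2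
      ≤ 4 * Real.sin (t / 2) ^ 2 * ∑ q ∈ Finset.range n, halfSine t n q ^ 2 := by
  have h1 : (1 : ℝ) ≤ n := by exact_mod_cast hn
  have hw0 : 0 ≤ Real.sin ((n - 1 / 2) * t) :=
    Real.sin_nonneg_of_nonneg_of_le_pi (mul_nonneg (by linarith) ht0.le) (by nlinarith)
  rw [sum_halfSine_gap ht0 (by linarith [Real.pi_pos]) hn]
  have := mul_le_mul_of_nonneg_left hw hw0
  nlinarith [sq_nonneg (Real.sin (t / 2))]

end HalfSine

end

section

/-- The weight of the leftmost truncation: a sine arc decreasing to zero before `n`. -/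
def leftTaper (t : ℝ) (n i : ℕ) : ℝ :=
  if i < n then max (Real.sin (3 * π / 4 - i * t)) 0 / √(2 * Real.sin t) else 0

/-- Total squared weight carried by block `j`. -/
def taperMass (t : ℝ) (n j : ℕ) : ℝ :=
  leftTaper t n j ^ 2 + ∑ q ∈ Finset.range j, halfSine t n q ^ 2

/-- Total squared weight increment between blocks `j` and `j + 1`. -/
def taperEnergy (t : ℝ) (n j : ℕ) : ℝ :=
  (leftTaper t n (j + 1) - leftTaper t n j) ^ 2
    + ∑ q ∈ Finset.range (j + 1), halfSineStep t n q ^ 2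

section Taper

variable {t : ℝ} {n : ℕ}

lemma leftTaper_of_le {i : ℕ} (hi : n ≤ i) : leftTaper t n i = 0 := by
  simp [leftTaper, not_lt.2 hi]

lemma leftTaper_of_nonneg (ht0 : 0 < t) (hn : 3 * π / 4 ≤ n * t) {i : ℕ}
    (hi : 0 ≤ 3 * π / 4 - i * t) :
    leftTaper t n i = Real.sin (3 * π / 4 - i * t) / √(2 * Real.sin t) := by
  have hs : 0 ≤ Real.sin (3 * π / 4 - i * t) := by
    have : 0 ≤ i * t := by positivity
    exact Real.sin_nonneg_of_nonneg_of_le_pi hi (by linarith [Real.pi_pos])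
  by_cases hlt : i < n
  · simp [leftTaper, hlt, hs]
  · rw [leftTaper_of_le (not_lt.1 hlt)]
    have h1 : (n : ℝ) * t ≤ i * t := by
      gcongr; exact_mod_cast not_lt.1 hlt
    have : 3 * π / 4 - i * t = 0 := by linarith
    simp [this]

lemma leftTaper_of_nonpos {i : ℕ} (hn1 : i * t ≤ π) (hi : 3 * π / 4 - i * t ≤ 0) :
    leftTaper t n i = 0 := by
  have hs : Real.sin (3 * π / 4 - i * t) ≤ 0 :=
    Real.sin_nonpos_of_nonpos_of_neg_pi_le hi (by linarith [Real.pi_pos])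
  by_cases hlt : i < n
  · simp [leftTaper, hlt, hs]
  · exact leftTaper_of_le (not_lt.1 hlt)

lemma cos_three_pi_div_two_sub (x : ℝ) : Real.cos (3 * π / 2 - x) = - Real.sin x := by
  rw [show 3 * π / 2 - x = (π / 2 - x) + π by ring, Real.cos_add_pi, Real.cos_pi_div_two_sub]

lemma sin_taper_sq (x : ℝ) :
    Real.sin (3 * π / 4 - x) ^ 2 = (1 + Real.sin (2 * x)) / 2 := by
  have := Real.cos_two_mul (3 * π / 4 - x)
  rw [show 2 * (3 * π / 4 - x) = 3 * π / 2 - 2 * x by ring, cos_three_pi_div_two_sub,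
    Real.cos_sq'] at this
  linarith

lemma sin_taper_step_sq (x : ℝ) :
    (Real.sin (3 * π / 4 - (x + t)) - Real.sin (3 * π / 4 - x)) ^ 2
      = 2 * Real.sin (t / 2) ^ 2 * (1 - Real.sin (2 * x + t)) := by
  have h1 := sin_half_sub (3 * π / 4 - (x + t / 2)) t
  rw [show 3 * π / 4 - (x + t / 2) + t / 2 = 3 * π / 4 - x by ring,
    show 3 * π / 4 - (x + t / 2) - t / 2 = 3 * π / 4 - (x + t) by ring] at h1
  have h2 := sin_taper_sq (x + t / 2)
  rw [show 2 * (x + t / 2) = 2 * x + t by ring, Real.sin_sq] at h2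
  rw [show (Real.sin (3 * π / 4 - (x + t)) - Real.sin (3 * π / 4 - x)) ^ 2
    = (Real.sin (3 * π / 4 - x) - Real.sin (3 * π / 4 - (x + t))) ^ 2 by ring, h1, mul_pow]
  have : Real.cos (3 * π / 4 - (x + t / 2)) ^ 2 = (1 - Real.sin (2 * x + t)) / 2 := by linarith
  rw [this]; ring

lemma taperMass_of_nonneg (ht0 : 0 < t) (ht : t < π) (hn : 3 * π / 4 ≤ n * t) {j : ℕ}
    (hjn : j ≤ n) (hj : 0 ≤ 3 * π / 4 - j * t) :
    taperMass t n j = 1 / (4 * Real.sin t) + j / 2 := by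
  have hs : 0 < Real.sin t := Real.sin_pos_of_pos_of_lt_pi ht0 ht
  rw [taperMass, leftTaper_of_nonneg ht0 hn hj, sum_halfSine_sq hs.ne' hjn, div_pow,
    Real.sq_sqrt (by positivity), sin_taper_sq, ← mul_assoc]
  field_simp
  ring

lemma taperMass_of_nonpos (ht0 : 0 < t) (ht : t < π) (hn1 : n * t ≤ π) {j : ℕ}
    (hjn : j ≤ n) (hj : 3 * π / 4 - j * t ≤ 0) :
    taperMass t n j = j / 2 - Real.sin (2 * j * t) / (4 * Real.sin t) := by
  have hs : 0 < Real.sin t := Real.sin_pos_of_pos_of_lt_pi ht0 ht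
  have h1 : (j : ℝ) * t ≤ n * t := by gcongr
  rw [taperMass, leftTaper_of_nonpos (by linarith) hj, sum_halfSine_sq hs.ne' hjn]
  ring

lemma taperEnergy_le (ht0 : 0 < t) (ht : t ≤ π / 3) (hn : 3 * π / 4 ≤ n * t)
    (hn1 : n * t ≤ π) {j : ℕ} (hjn : j < n) :
    taperEnergy t n j ≤ 4 * Real.sin (t / 2) ^ 2 * taperMass t n j := by
  have hpi := Real.pi_pos
  have hs : 0 < Real.sin t := Real.sin_pos_of_pos_of_lt_pi ht0 (by linarith)
  have hj1 : ((j : ℝ) + 1) * t ≤ n * t := by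
    gcongr; exact_mod_cast hjn
  have hcast : (((j + 1 : ℕ) : ℝ)) * t = j * t + t := by push_cast; ring
  have harg : (2 * (j : ℝ) + 1) * t = 2 * (j * t) + t := by ring
  rcases le_total 0 (3 * π / 4 - j * t) with hj | hj
  · have hstep : (leftTaper t n (j + 1) - leftTaper t n j) ^ 2
        ≤ Real.sin (t / 2) ^ 2 * (1 - Real.sin ((2 * j + 1) * t)) / Real.sin t := by
      have hfull : ((Real.sin (3 * π / 4 - ((j + 1 : ℕ) : ℝ) * t)
          - Real.sin (3 * π / 4 - j * t)) / √(2 * Real.sin t)) ^ 2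
          = Real.sin (t / 2) ^ 2 * (1 - Real.sin ((2 * j + 1) * t)) / Real.sin t := by
        rw [div_pow, Real.sq_sqrt (by positivity), hcast, sin_taper_step_sq, harg]
        field_simp
      rw [← hfull, leftTaper_of_nonneg ht0 hn hj]
      rcases le_total 0 (3 * π / 4 - ((j + 1 : ℕ) : ℝ) * t) with h2 | h2
      · rw [leftTaper_of_nonneg ht0 hn h2, sub_div]
      · rw [leftTaper_of_nonpos (by rw [hcast]; linarith) h2]
        have hneg : Real.sin (3 * π / 4 - ((j + 1 : ℕ) : ℝ) * t) ≤ 0 :=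
          Real.sin_nonpos_of_nonpos_of_neg_pi_le h2 (by rw [hcast]; linarith)
        have hpos : 0 ≤ Real.sin (3 * π / 4 - j * t) :=
          Real.sin_nonneg_of_nonneg_of_le_pi hj (by nlinarith [Nat.cast_nonneg (α := ℝ) j])
        rw [zero_sub, neg_sq, div_pow, div_pow]
        gcongr ?_ / _
        nlinarith
    rw [taperEnergy, taperMass_of_nonneg ht0 (by linarith) hn hjn.le hj,
      sum_halfSineStep_sq hs.ne' hjn]
    refine (add_le_add_left hstep _).trans (le_of_eq ?_)
    field_simp
    ring
  · have h1 : leftTaper t n j = 0 := leftTaper_of_nonpos (by linarith) hj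
    have h2 : leftTaper t n (j + 1) = 0 :=
      leftTaper_of_nonpos (by rw [hcast]; linarith) (by rw [hcast]; linarith)
    rw [taperEnergy, taperMass_of_nonpos ht0 (by linarith) hn1 hjn.le hj,
      sum_halfSineStep_sq hs.ne' hjn, h1, h2]
    have hsum : Real.sin (2 * j * t) + Real.sin ((2 * j + 1) * t) ≤ 0 := by
      have e : Real.sin (2 * j * t) + Real.sin ((2 * j + 1) * t)
          = 2 * Real.sin (2 * (j * t) + t / 2) * Real.cos (t / 2) := by
        rw [show 2 * (j : ℝ) * t = (2 * (j * t) + t / 2) - t / 2 by ring,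
          show (2 * (j : ℝ) + 1) * t = (2 * (j * t) + t / 2) + t / 2 by ring,
          Real.sin_sub (2 * (j * t) + t / 2), Real.sin_add (2 * (j * t) + t / 2)]; ring
      have hk : 0 ≤ Real.cos (t / 2) := Real.cos_nonneg_of_mem_Icc ⟨by linarith, by linarith⟩
      have hneg : Real.sin (2 * (j * t) + t / 2) ≤ 0 := by
        rw [← Real.sin_sub_two_pi]
        exact Real.sin_nonpos_of_nonpos_of_neg_pi_le (by linarith) (by linarith)
      rw [e]
      nlinarith [mul_nonneg hk (neg_nonneg.2 hneg)]
    have : 4 * Real.sin (t / 2) ^ 2 * (j / 2 - Real.sin (2 * j * t) / (4 * Real.sin t))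
        - (2 * Real.sin (t / 2) ^ 2 * j
          + Real.sin (t / 2) ^ 2 * Real.sin ((2 * j + 1) * t) / Real.sin t)
        = - (Real.sin (2 * j * t) + Real.sin ((2 * j + 1) * t)) * Real.sin (t / 2) ^ 2
          / Real.sin t := by
      field_simp; ring
    have h3 : 0 ≤ - (Real.sin (2 * j * t) + Real.sin ((2 * j + 1) * t)) * Real.sin (t / 2) ^ 2
          / Real.sin t :=
      div_nonneg (mul_nonneg (by linarith) (sq_nonneg _)) hs.le
    linarith

lemma taperMass_le_succ (ht0 : 0 < t) (ht : t ≤ π / 3) (hn : 3 * π / 4 ≤ n * t)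
    (hn1 : n * t ≤ π) (j : ℕ) : taperMass t n j ≤ taperMass t n (j + 1) := by
  have hpi := Real.pi_pos
  have hs : 0 < Real.sin t := Real.sin_pos_of_pos_of_lt_pi ht0 (by linarith)
  by_cases hjn : j < n
  swap
  · have hjn' := not_lt.1 hjn
    rw [taperMass, taperMass, leftTaper_of_le hjn', leftTaper_of_le (hjn'.trans (Nat.le_succ j)),
      sum_halfSine_sq_of_le hjn', sum_halfSine_sq_of_le (hjn'.trans (Nat.le_succ j))]
  have hj1 : ((j : ℝ) + 1) * t ≤ n * t := by
    gcongr; exact_mod_cast hjn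
  have hcast : (((j + 1 : ℕ) : ℝ)) * t = j * t + t := by push_cast; ring
  rcases le_total 0 (3 * π / 4 - j * t) with hj | hj
  · rw [taperMass_of_nonneg ht0 (by linarith) hn hjn.le hj]
    rcases le_total 0 (3 * π / 4 - ((j + 1 : ℕ) : ℝ) * t) with h2 | h2
    · rw [taperMass_of_nonneg ht0 (by linarith) hn hjn h2]
      push_cast; linarith
    · rw [taperMass_of_nonpos ht0 (by linarith) hn1 hjn h2]
      have h3 : Real.sin (3 * π / 4 - ((j + 1 : ℕ) : ℝ) * t) ^ 2 ≤ Real.sin t ^ 2 := by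
        rw [← neg_sq, ← Real.sin_neg]
        have hle : Real.sin (-(3 * π / 4 - ((j + 1 : ℕ) : ℝ) * t)) ≤ Real.sin t :=
          Real.sin_le_sin_of_le_of_le_pi_div_two (by linarith) (by linarith)
            (by rw [hcast]; linarith)
        have hge : 0 ≤ Real.sin (-(3 * π / 4 - ((j + 1 : ℕ) : ℝ) * t)) :=
          Real.sin_nonneg_of_nonneg_of_le_pi (by linarith) (by rw [hcast]; linarith)
        gcongr
      rw [sin_taper_sq, ← mul_assoc] at h3
      have h1 := Real.sin_le_one t
      have h4 : (1 + Real.sin (2 * ((j + 1 : ℕ) : ℝ) * t)) / (4 * Real.sin t) ≤ 1 / 2 := by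
        rw [div_le_iff₀ (by positivity)]
        nlinarith
      rw [add_div] at h4
      push_cast at h4 ⊢
      linarith
  · rw [taperMass, taperMass, leftTaper_of_nonpos (by linarith) hj,
      leftTaper_of_nonpos (by rw [hcast]; linarith) (by rw [hcast]; linarith),
      Finset.sum_range_succ]
    nlinarith [sq_nonneg (halfSine t n j)]

lemma taperMass_mono (ht0 : 0 < t) (ht : t ≤ π / 3) (hn : 3 * π / 4 ≤ n * t)
    (hn1 : n * t ≤ π) : Monotone (taperMass t n) :=
  monotone_nat_of_le_succ (taperMass_le_succ ht0 ht hn hn1)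

lemma taperMass_of_le {j : ℕ} (hj : n ≤ j) :
    taperMass t n j = ∑ q ∈ Finset.range n, halfSine t n q ^ 2 := by
  rw [taperMass, leftTaper_of_le hj, sum_halfSine_sq_of_le hj]; ring

/-- The row-weighted energy bound: rows past the end of a window are not counted. -/
lemma taper_energy_balance {ρL ρU : ℝ} (hL : 0 ≤ ρL) (hU : 0 ≤ ρU) (hs : ρL + ρU = 1)
    (ht0 : 0 < t) (ht : t ≤ π / 3) (hn : 3 * π / 4 ≤ n * t) (hn1 : n * t ≤ π)
    (hw : Real.sin ((n + 1 / 2) * t) ≤ ρL * Real.sin ((n - 1 / 2) * t)) (j : ℕ) :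
    ρL * ((if j + 1 < n then (leftTaper t n (j + 1) - leftTaper t n j) ^ 2 else 0)
        + ∑ q ∈ Finset.range (min (j + 1) n), halfSineStep t n q ^ 2)
      + ρU * (if j = 0 then 0 else taperEnergy t n (j - 1))
      ≤ 4 * Real.sin (t / 2) ^ 2 * taperMass t n j := by
  have hn0 : 0 < n := by
    rcases Nat.eq_zero_or_pos n with rfl | h
    · have := Real.pi_pos
      simp at hn; linarith
    · exact h
  have hΛ : 0 ≤ 4 * Real.sin (t / 2) ^ 2 := by positivity
  have hmono := taperMass_mono ht0 ht hn hn1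
  have htail := sum_halfSineStep_add_le hs ht0 ht hn0 hn1 hw
  have hprev (hj : j ≤ n) : (if j = 0 then 0 else taperEnergy t n (j - 1))
      ≤ 4 * Real.sin (t / 2) ^ 2 * taperMass t n j := by
    split_ifs with h0
    · exact mul_nonneg hΛ (by unfold taperMass; positivity)
    · exact (taperEnergy_le ht0 ht hn hn1 (by omega)).trans
        (mul_le_mul_of_nonneg_left (hmono (by omega)) hΛ)
  have hcomb {A B C : ℝ} (hA : A ≤ C) (hB : B ≤ C) : ρL * A + ρU * B ≤ C := by
    have hC : C = ρL * C + ρU * C := by rw [← add_mul, hs, one_mul]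
    rw [hC]
    gcongr
  rcases lt_trichotomy j n with hjn | rfl | hjn
  · refine hcomb (le_trans ?_ (taperEnergy_le ht0 ht hn hn1 hjn)) (hprev hjn.le)
    rw [taperEnergy, min_eq_left (by omega : j + 1 ≤ n)]
    gcongr
    split_ifs
    · exact le_rfl
    · positivity
  · refine hcomb ?_ (hprev le_rfl)
    rw [if_neg (by omega), min_eq_right (by omega), taperMass_of_le le_rfl, zero_add]
    nlinarith [mul_nonneg hU (sq_nonneg (Real.sin ((j - 1 / 2) * t)))]
  · rw [if_neg (by omega), min_eq_right (by omega), taperMass_of_le hjn.le, zero_add,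
      if_neg (by omega), taperEnergy, leftTaper_of_le (by omega), leftTaper_of_le (by omega),
      sum_halfSineStep_sq_of_le hn0 (by omega)]
    refine le_trans (le_of_eq ?_) htail
    have : ρL = 1 - ρU := by linarith
    rw [this]; ring

lemma one_add_sq_le_of_mem {k g : ℝ} (hk : 3 / 4 ≤ k ^ 2) (hk1 : k ≤ 1) (hk2 : 1 / 2 ≤ k)
    (hg : 1 ≤ k * g) (hg1 : g ≤ 13) : 1 + (1 - k ^ 2) * g ^ 2 / 2 ^ 2 ≤ g := by
  have key : k * (13 * k - 1) * (g - (1 + (1 - k ^ 2) * g ^ 2 / 2 ^ 2))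
      = (13 - g) * ((1 - k) * (3 * k - 1) / 4) + k * ((k * g - 1) * (12 - (1 - k ^ 2) * 169 / 4))
        + (1 - k ^ 2) / 4 * ((k * g - 1) * (13 - g)) * (13 * k - 1) := by ring
  have h1 : 0 ≤ (13 - g) * ((1 - k) * (3 * k - 1) / 4) :=
    mul_nonneg (by linarith) (div_nonneg (mul_nonneg (by linarith) (by linarith)) (by norm_num))
  have h2 : 0 ≤ k * ((k * g - 1) * (12 - (1 - k ^ 2) * 169 / 4)) :=
    mul_nonneg (by linarith) (mul_nonneg (by linarith) (by linarith))
  have h3 : 0 ≤ (1 - k ^ 2) / 4 * ((k * g - 1) * (13 - g)) * (13 * k - 1) :=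
    mul_nonneg (mul_nonneg (by nlinarith) (mul_nonneg (by linarith) (by linarith)))
      (by linarith)
  have h4 : 0 ≤ k * (13 * k - 1) * (g - (1 + (1 - k ^ 2) * g ^ 2 / 2 ^ 2)) := by linarith
  have h5 := nonneg_of_mul_nonneg_right h4 (mul_pos (by linarith) (by linarith))
  linarith

set_option maxHeartbeats 400000 in
lemma taper_energy_sq_le (hn3 : 3 ≤ n) (ht0 : 0 < t) (ht : t ≤ π / 3) (hn : 3 * π / 4 ≤ n * t)
    (hn1 : n * t ≤ π) (j : ℕ) :
    1 + taperEnergy t n j ^ 2 ≤ 8 * Real.sin (t / 2) * taperMass t n j := by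
  have hpi := Real.pi_pos
  have hs : 0 < Real.sin t := Real.sin_pos_of_pos_of_lt_pi ht0 (by linarith)
  have hst : Real.sin t = 2 * Real.sin (t / 2) * Real.cos (t / 2) := by
    rw [← Real.sin_two_mul]; ring_nf
  have hh : 0 < Real.sin (t / 2) := Real.sin_pos_of_pos_of_lt_pi (by linarith) (by linarith)
  have hh2 : Real.sin (t / 2) ≤ 1 / 2 := by
    rw [← Real.sin_pi_div_six]
    exact Real.sin_le_sin_of_le_of_le_pi_div_two (by linarith) (by linarith) (by linarith)
  have hk : 1 / 2 ≤ Real.cos (t / 2) := by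
    rw [← Real.cos_pi_div_three]
    exact Real.cos_le_cos_of_nonneg_of_le_pi (by linarith) (by linarith) (by linarith)
  have hk1 := Real.cos_le_one (t / 2)
  have hsq := Real.sin_sq_add_cos_sq (t / 2)
  have hn3' : (3 : ℝ) ≤ n := by exact_mod_cast hn3
  have hht : Real.sin (t / 2) ≤ t / 2 := Real.sin_le (by linarith)
  have hG : 4 * n * Real.sin (t / 2) ≤ 2 * π := by nlinarith
  have hpi2 := Real.pi_lt_d2
  have hmono := taperMass_mono ht0 ht hn hn1
  have hlast : taperMass t n n = n / 2 - Real.sin (2 * n * t) / (4 * Real.sin t) :=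
    taperMass_of_nonpos ht0 (by linarith) hn1 le_rfl (by linarith)
  by_cases hjn : j < n
  · have hE := taperEnergy_le ht0 ht hn hn1 hjn
    have hE0 : 0 ≤ taperEnergy t n j := by unfold taperEnergy; positivity
    have hfirst : taperMass t n 0 = 1 / (4 * Real.sin t) := by
      rw [taperMass_of_nonneg ht0 (by linarith) hn (Nat.zero_le n) (by simp; linarith)]
      simp
    have hlow : 1 ≤ Real.cos (t / 2) * (8 * Real.sin (t / 2) * taperMass t n j) := by
      have := hmono (Nat.zero_le j)
      rw [hfirst, div_le_iff₀ (by positivity), hst] at this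
      linarith
    have hup : 8 * Real.sin (t / 2) * taperMass t n j ≤ 13 := by
      have h1 := hmono hjn.le
      have h2 : taperMass t n n ≤ n / 2 + 1 / (4 * Real.sin t) := by
        rw [hlast]
        have : - (1 / (4 * Real.sin t)) ≤ Real.sin (2 * n * t) / (4 * Real.sin t) := by
          rw [← neg_div]
          gcongr
          exact Real.neg_one_le_sin _
        linarith
      have h3 : 8 * Real.sin (t / 2) * (1 / (4 * Real.sin t)) ≤ 2 := by
        rw [hst, mul_one_div, div_le_iff₀ (by positivity)]
        nlinarith
      have h4 := mul_le_mul_of_nonneg_left (h1.trans h2)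
        (by positivity : 0 ≤ 8 * Real.sin (t / 2))
      linarith
    set g := 8 * Real.sin (t / 2) * taperMass t n j with hg
    have hEg : taperEnergy t n j ≤ Real.sin (t / 2) * g / 2 := by
      refine hE.trans (le_of_eq ?_)
      rw [hg]; ring
    have hEsq : taperEnergy t n j ^ 2 ≤ (Real.sin (t / 2) * g / 2) ^ 2 := by gcongr
    refine (add_le_add_right hEsq 1).trans ?_
    generalize Real.sin (t / 2) = h at *
    generalize Real.cos (t / 2) = k at *
    have hg1 : 1 ≤ g := by nlinarith
    have hh' : h ^ 2 = 1 - k ^ 2 := by linarith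
    rw [div_pow, mul_pow, hh']
    have hk34 : 3 / 4 ≤ k ^ 2 := by nlinarith
    exact one_add_sq_le_of_mem hk34 hk1 (by linarith) hlow hup
  · have hjn' := not_lt.1 hjn
    rw [taperMass_of_le hjn', ← taperMass_of_le le_rfl, hlast, taperEnergy, leftTaper_of_le hjn',
      leftTaper_of_le (hjn'.trans (Nat.le_succ j)), sum_halfSineStep_sq_of_le (by omega) hjn']
    obtain ⟨p, rfl⟩ : ∃ p, n = p + 1 := ⟨n - 1, by omega⟩
    rw [sum_halfSineStep_sq hs.ne' (Nat.lt_succ_self p)]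
    have s1 : Real.sin ((2 * (p : ℝ) + 1) * t) ≤ 0 := by
      push_cast at hn hn1
      rw [← Real.sin_sub_two_pi]
      exact Real.sin_nonpos_of_nonpos_of_neg_pi_le (by linarith) (by linarith)
    have s2 : Real.sin (2 * ((p + 1 : ℕ) : ℝ) * t) ≤ 0 := by
      rw [← Real.sin_sub_two_pi]
      exact Real.sin_nonpos_of_nonpos_of_neg_pi_le (by linarith) (by linarith)
    have s3 : Real.sin (t / 2) ^ 2 * Real.sin ((2 * (p : ℝ) + 1) * t) / Real.sin t ≤ 0 :=
      div_nonpos_of_nonpos_of_nonneg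
        (mul_nonpos_of_nonneg_of_nonpos (sq_nonneg _) s1) hs.le
    have s4 : Real.sin (2 * ((p + 1 : ℕ) : ℝ) * t) / (4 * Real.sin t) ≤ 0 :=
      div_nonpos_of_nonpos_of_nonneg s2 (by positivity)
    have s5 : Real.sin ((((p + 1 : ℕ) : ℝ) - 1 / 2) * t) ^ 2 ≤ 1 := Real.sin_sq_le_one _
    have hJ : 2 / π * (t / 2) ≤ Real.sin (t / 2) :=
      Real.mul_le_sin (by linarith) (by linarith)
    have hJ' : t ≤ π * Real.sin (t / 2) := by
      have := mul_le_mul_of_nonneg_left hJ hpi.le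
      field_simp at this
      linarith
    have hG3 : 3 ≤ 4 * ((p + 1 : ℕ) : ℝ) * Real.sin (t / 2) := by
      have := mul_le_mul_of_nonneg_left hJ' (Nat.cast_nonneg (α := ℝ) (p + 1))
      have h2 : π * (3 / 4) ≤ π * (((p + 1 : ℕ) : ℝ) * Real.sin (t / 2)) := by linarith
      have := le_of_mul_le_mul_left h2 hpi
      linarith
    have hGh : 12 * Real.sin (t / 2) ≤ 4 * ((p + 1 : ℕ) : ℝ) * Real.sin (t / 2) :=
      mul_le_mul_of_nonneg_right (by linarith) hh.le
    have hE0 : 0 ≤ (0 - 0 : ℝ) ^ 2 + (2 * Real.sin (t / 2) ^ 2 * p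
        + Real.sin (t / 2) ^ 2 * Real.sin ((2 * (p : ℝ) + 1) * t) / Real.sin t
        + Real.sin ((((p + 1 : ℕ) : ℝ) - 1 / 2) * t) ^ 2) := by
      rw [← sum_halfSineStep_sq hs.ne' (Nat.lt_succ_self p)]
      positivity
    have hE : (0 - 0 : ℝ) ^ 2 + (2 * Real.sin (t / 2) ^ 2 * p
        + Real.sin (t / 2) ^ 2 * Real.sin ((2 * (p : ℝ) + 1) * t) / Real.sin t
        + Real.sin ((((p + 1 : ℕ) : ℝ) - 1 / 2) * t) ^ 2)
        ≤ (4 * ((p + 1 : ℕ) : ℝ) * Real.sin (t / 2)) / 4 + 1 / 2 := by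
      push_cast at *
      have : 0 ≤ (1 / 2 - Real.sin (t / 2))
          * (4 * ((p : ℝ) + 1) * Real.sin (t / 2) / 2 - 1 - 2 * Real.sin (t / 2)) := by
        refine mul_nonneg (by linarith) ?_
        rcases le_total (Real.sin (t / 2)) (1 / 4) with h | h <;> linarith
      linarith
    have hEsq := pow_le_pow_left₀ hE0 hE 2
    refine (add_le_add_right hEsq 1).trans ?_
    have hgoal : 4 * ((p + 1 : ℕ) : ℝ) * Real.sin (t / 2)
        ≤ 8 * Real.sin (t / 2) * (((p + 1 : ℕ) : ℝ) / 2
          - Real.sin (2 * ((p + 1 : ℕ) : ℝ) * t) / (4 * Real.sin t)) := by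
      linarith [mul_nonneg hh.le (neg_nonneg.2 s4)]
    refine le_trans ?_ hgoal
    generalize 4 * ((p + 1 : ℕ) : ℝ) * Real.sin (t / 2) = G at *
    nlinarith [mul_nonneg (by linarith : 0 ≤ G - 2) (by linarith : 0 ≤ 10 - G)]

end Taper

end

section

variable {E : Type*} [NormedAddCommGroup E] [InnerProductSpace ℝ E]

/-- `P 0, …, P (N - 1)` are mutually orthogonal projections summing to the identity, and `T` is
block tridiagonal with respect to them, with off-diagonal blocks bounded by `l` and `u`. -/
structure BlockTridiag (N : ℕ) (P : ℕ → E →ₗ[ℝ] E) (T : E →ₗ[ℝ] E) (l u : ℝ) : Prop where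
  proj_self : ∀ i x, P i (P i x) = P i x
  proj_ne : ∀ i j x, i ≠ j → P i (P j x) = 0
  proj_ge : ∀ i x, N ≤ i → P i x = 0
  sum_proj : ∀ x, ∑ i ∈ Finset.range N, P i x = x
  symm : ∀ i x y, inner ℝ (P i x) y = inner ℝ x (P i y)
  tri : ∀ i j x, i + 1 < j ∨ j + 1 < i → P i (T (P j x)) = 0
  lower : ∀ j x, ‖P (j + 1) (T (P j x))‖ ≤ l * ‖P j x‖
  upper : ∀ j x, ‖P j (T (P (j + 1) x))‖ ≤ u * ‖P (j + 1) x‖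

/-- Every window of `n` consecutive blocks has its smallest singular value at least `s`. -/
def WindowBound (N n : ℕ) (P : ℕ → E →ₗ[ℝ] E) (T : E →ₗ[ℝ] E) (s : ℝ) : Prop :=
  ∀ k, k + n ≤ N → ∀ z, (∀ i, i < k ∨ k + n ≤ i → P i z = 0) →
    s ^ 2 * ‖z‖ ^ 2 ≤ ∑ i ∈ Finset.Ico k (k + n), ‖P i (T z)‖ ^ 2

/-- Multiplication of the `i`-th block by the scalar `w i`. -/
def blockScale (N : ℕ) (P : ℕ → E →ₗ[ℝ] E) (w : ℕ → ℝ) (x : E) : E :=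
  ∑ i ∈ Finset.range N, w i • P i x

/-- The contribution of the preceding block to the `i`-th block of `T x`. -/
def lowerPart (P : ℕ → E →ₗ[ℝ] E) (T : E →ₗ[ℝ] E) (x : E) (i : ℕ) : E :=
  if i = 0 then 0 else P i (T (P (i - 1) x))

namespace BlockTridiag

variable {N : ℕ} {P : ℕ → E →ₗ[ℝ] E} {T : E →ₗ[ℝ] E} {l u : ℝ}

lemma inner_eq_sum (H : BlockTridiag N P T l u) (x y : E) :
    inner ℝ x y = ∑ i ∈ Finset.range N, inner ℝ (P i x) (P i y) := by
  conv_lhs => rw [← H.sum_proj y]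
  rw [inner_sum]
  refine Finset.sum_congr rfl fun i _ => ?_
  rw [H.symm, H.proj_self]

lemma norm_sq_eq_sum (H : BlockTridiag N P T l u) (x : E) :
    ‖x‖ ^ 2 = ∑ i ∈ Finset.range N, ‖P i x‖ ^ 2 := by
  rw [← real_inner_self_eq_norm_sq, H.inner_eq_sum]
  simp

lemma norm_proj_le (H : BlockTridiag N P T l u) (i : ℕ) (x : E) : ‖P i x‖ ≤ ‖x‖ := by
  by_cases hi : i < N
  · rw [← sq_le_sq₀ (norm_nonneg _) (norm_nonneg _), H.norm_sq_eq_sum x]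
    exact Finset.single_le_sum (f := fun i => ‖P i x‖ ^ 2) (fun _ _ => sq_nonneg _)
      (Finset.mem_range.2 hi)
  · rw [H.proj_ge i x (not_lt.1 hi), norm_zero]; exact norm_nonneg x

lemma proj_blockScale (H : BlockTridiag N P T l u) (w : ℕ → ℝ) (x : E) (i : ℕ) :
    P i (blockScale N P w x) = w i • P i x := by
  by_cases hi : i < N
  · rw [blockScale, map_sum, Finset.sum_eq_single i]
    · rw [map_smul, H.proj_self]
    · intro j _ hj
      rw [map_smul, H.proj_ne i j x hj.symm, smul_zero]
    · intro h; exact absurd (Finset.mem_range.2 hi) h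
  · rw [H.proj_ge i _ (not_lt.1 hi), H.proj_ge i _ (not_lt.1 hi), smul_zero]

lemma norm_blockScale_sq (H : BlockTridiag N P T l u) (w : ℕ → ℝ) (x : E) :
    ‖blockScale N P w x‖ ^ 2 = ∑ i ∈ Finset.range N, w i ^ 2 * ‖P i x‖ ^ 2 := by
  rw [H.norm_sq_eq_sum]
  refine Finset.sum_congr rfl fun i _ => ?_
  rw [H.proj_blockScale, norm_smul, mul_pow, Real.norm_eq_abs, sq_abs]

lemma row_eq (H : BlockTridiag N P T l u) (x : E) {i : ℕ} (hi : i < N) :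
    P i (T x) = lowerPart P T x i + P i (T (P i x)) + P i (T (P (i + 1) x)) := by
  conv_lhs => rw [← H.sum_proj x]
  rw [map_sum, map_sum]
  have h1 : ∑ j ∈ Finset.range N, P i (T (P j x))
      = ∑ j ∈ Finset.range (N + 1), P i (T (P j x)) := by
    rw [Finset.sum_range_succ, H.proj_ge N x le_rfl]; simp
  rw [h1]
  rcases Nat.eq_zero_or_pos i with rfl | hpos
  · have h2 : Finset.range 2 ⊆ Finset.range (N + 1) := Finset.range_mono (by omega)
    rw [← Finset.sum_subset h2 fun j _ hj => H.tri 0 j x (by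
      left; simp at hj; omega)]
    simp [Finset.sum_range_succ, lowerPart]
  · have h2 : {i - 1, i, i + 1} ⊆ Finset.range (N + 1) := by
      intro j hj; simp at hj ⊢; omega
    rw [← Finset.sum_subset h2 fun j _ hj => H.tri i j x (by simp at hj; omega)]
    rw [Finset.sum_insert (by simp; omega), Finset.sum_insert (by simp), Finset.sum_singleton,
      lowerPart, if_neg hpos.ne', add_assoc]

lemma lowerPart_blockScale (H : BlockTridiag N P T l u) (w : ℕ → ℝ) (x : E) (i : ℕ) :
    lowerPart P T (blockScale N P w x) i = w (i - 1) • lowerPart P T x i := by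
  unfold lowerPart
  split_ifs
  · rw [smul_zero]
  · rw [H.proj_blockScale, map_smul, map_smul]

lemma row_blockScale (H : BlockTridiag N P T l u) (w : ℕ → ℝ) (x : E) {i : ℕ} (hi : i < N) :
    P i (T (blockScale N P w x)) = w i • P i (T x)
      + ((w (i - 1) - w i) • lowerPart P T x i
        + (w (i + 1) - w i) • P i (T (P (i + 1) x))) := by
  rw [H.row_eq _ hi, H.row_eq x hi, H.lowerPart_blockScale, H.proj_blockScale,
    H.proj_blockScale, map_smul, map_smul, map_smul, map_smul]
  module

lemma norm_lowerPart_le (H : BlockTridiag N P T l u) (hl : 0 ≤ l) (x : E) (i : ℕ) :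
    ‖lowerPart P T x i‖ ≤ l * ‖P (i - 1) x‖ := by
  unfold lowerPart
  split_ifs with h
  · rw [norm_zero]; positivity
  · obtain ⟨j, rfl⟩ : ∃ j, i = j + 1 := ⟨i - 1, by omega⟩
    exact H.lower j x

/-- Stationarity of a vector minimizing `‖T x‖` on the unit sphere. -/
lemma inner_map_eq_of_minimal {ν : ℝ} {x : E} (hx : ‖x‖ = 1) (hTx : ‖T x‖ = ν)
    (hmin : ∀ z, ν * ‖z‖ ≤ ‖T z‖) (z : E) :
    inner ℝ (T x) (T z) = ν ^ 2 * inner ℝ x z := by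
  have hν : 0 ≤ ν := hTx ▸ norm_nonneg _
  have key (c : ℝ) : 0 ≤ (‖T z‖ ^ 2 - ν ^ 2 * ‖z‖ ^ 2) * (c * c)
      + (2 * (inner ℝ (T x) (T z) - ν ^ 2 * inner ℝ x z)) * c + 0 := by
    have h1 := pow_le_pow_left₀ (by positivity) (hmin (x + c • z)) 2
    rw [mul_pow, map_add, map_smul, norm_add_sq_real, norm_add_sq_real, inner_smul_right,
      inner_smul_right, norm_smul, norm_smul, mul_pow, mul_pow, Real.norm_eq_abs, sq_abs, hx,
      hTx] at h1
    linarith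
  have := discrim_le_zero key
  rw [discrim] at this
  have h0 : (2 * (inner ℝ (T x) (T z) - ν ^ 2 * inner ℝ x z)) ^ 2 = 0 :=
    le_antisymm (by linarith) (sq_nonneg _)
  have := pow_eq_zero_iff (two_ne_zero) |>.1 h0
  linarith

end BlockTridiag

end

section

lemma sum_neighbor_le {N : ℕ} {p q ξ : ℕ → ℝ} (hp : ∀ i, 0 ≤ p i) (hp0 : p 0 = 0)
    (hq0 : 0 ≤ q 0) (hξ : ξ N = 0) :
    ∑ i ∈ Finset.range N, (p i * ξ (i - 1) ^ 2 + q (i + 1) * ξ (i + 1) ^ 2)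
      ≤ ∑ j ∈ Finset.range N, (p (j + 1) + q j) * ξ j ^ 2 := by
  have h1 : ∑ i ∈ Finset.range N, p i * ξ (i - 1) ^ 2
      ≤ ∑ j ∈ Finset.range N, p (j + 1) * ξ j ^ 2 := by
    have e := Finset.sum_range_succ' (fun i => p i * ξ (i - 1) ^ 2) N
    rw [Finset.sum_range_succ] at e
    simp only [Nat.add_sub_cancel, hp0, zero_mul, add_zero] at e
    have := mul_nonneg (hp N) (sq_nonneg (ξ (N - 1)))
    linarith
  have h2 : ∑ i ∈ Finset.range N, q (i + 1) * ξ (i + 1) ^ 2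
      ≤ ∑ j ∈ Finset.range N, q j * ξ j ^ 2 := by
    have e := Finset.sum_range_succ' (fun i => q i * ξ i ^ 2) N
    rw [Finset.sum_range_succ, hξ] at e
    have := mul_nonneg hq0 (sq_nonneg (ξ 0))
    linarith
  rw [Finset.sum_add_distrib]
  simp only [add_mul]
  rw [Finset.sum_add_distrib]
  exact add_le_add h1 h2

variable {E : Type*} [NormedAddCommGroup E] [InnerProductSpace ℝ E]

lemma norm_smul_add_smul_sq_le {a b r ρL ρU ξ η : ℝ} {v w : E} (hL : 0 ≤ ρL) (hU : 0 ≤ ρU)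
    (hs : ρL + ρU = 1) (hv : ‖v‖ ≤ r * ρL * ξ) (hw : ‖w‖ ≤ r * ρU * η) :
    ‖a • v + b • w‖ ^ 2 ≤ r ^ 2 * (ρL * a ^ 2 * ξ ^ 2 + ρU * b ^ 2 * η ^ 2) := by
  have h1 : ‖a • v + b • w‖ ≤ r * (ρL * (|a| * ξ) + ρU * (|b| * η)) := by
    refine (norm_add_le _ _).trans ?_
    rw [norm_smul, norm_smul, Real.norm_eq_abs, Real.norm_eq_abs]
    have := mul_le_mul_of_nonneg_left hv (abs_nonneg a)
    have := mul_le_mul_of_nonneg_left hw (abs_nonneg b)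
    linarith
  have h2 := pow_le_pow_left₀ (norm_nonneg _) h1 2
  refine h2.trans ?_
  rw [mul_pow]
  refine mul_le_mul_of_nonneg_left ?_ (sq_nonneg r)
  rw [← sq_abs a, ← sq_abs b]
  have hU' : ρU = 1 - ρL := by linarith
  subst hU'
  nlinarith [mul_nonneg (mul_nonneg hL hU) (sq_nonneg (|a| * ξ - |b| * η))]

namespace BlockTridiag

variable {N : ℕ} {P : ℕ → E →ₗ[ℝ] E} {T : E →ₗ[ℝ] E} {r ρL ρU : ℝ}

lemma norm_offdiag_sq_le (H : BlockTridiag N P T (r * ρL) (r * ρU)) (hr : 0 ≤ r) (hL : 0 ≤ ρL)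
    (hU : 0 ≤ ρU) (hs : ρL + ρU = 1) (x : E) (a b : ℝ) (i : ℕ) :
    ‖a • lowerPart P T x i + b • P i (T (P (i + 1) x))‖ ^ 2
      ≤ r ^ 2 * (ρL * a ^ 2 * ‖P (i - 1) x‖ ^ 2 + ρU * b ^ 2 * ‖P (i + 1) x‖ ^ 2) :=
  norm_smul_add_smul_sq_le hL hU hs
    (H.norm_lowerPart_le (mul_nonneg hr hL) x i) (H.upper i x)

/-- The part of `∑ₖ ‖T (Wₖ x)‖²` that is quadratic in `T x` is reduced, by stationarity of `x`,
to the total mass and the total energy of the weights. -/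
lemma sum_cross_eq {l u : ℝ} (H : BlockTridiag N P T l u) {ν : ℝ} {x : E} (hx : ‖x‖ = 1)
    (hTx : ‖T x‖ = ν) (hmin : ∀ z, ν * ‖z‖ ≤ ‖T z‖) (M : ℕ) (W : ℕ → ℕ → ℝ) :
    ∑ i ∈ Finset.range N, ∑ k ∈ Finset.range M, (W k i ^ 2 * ‖P i (T x)‖ ^ 2
        + 2 * (W k i * inner ℝ (P i (T x)) ((W k (i - 1) - W k i) • lowerPart P T x i
          + (W k (i + 1) - W k i) • P i (T (P (i + 1) x)))))
      = ν ^ 2 * ∑ i ∈ Finset.range N, (∑ k ∈ Finset.range M, W k i ^ 2) * ‖P i x‖ ^ 2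
        - ∑ i ∈ Finset.range N,
          ((∑ k ∈ Finset.range M, (W k i - W k (i - 1)) ^ 2)
              * inner ℝ (P i (T x)) (lowerPart P T x i)
            + (∑ k ∈ Finset.range M, (W k (i + 1) - W k i) ^ 2)
              * inner ℝ (P i (T x)) (P i (T (P (i + 1) x)))) := by
  set S : ℕ → ℝ := fun i => ∑ k ∈ Finset.range M, W k i ^ 2 with hS
  have hst := inner_map_eq_of_minimal hx hTx hmin (blockScale N P S x)
  rw [H.inner_eq_sum, H.inner_eq_sum x] at hst
  have h1 : ∑ i ∈ Finset.range N, inner ℝ (P i x) (P i (blockScale N P S x))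
      = ∑ i ∈ Finset.range N, S i * ‖P i x‖ ^ 2 := by
    refine Finset.sum_congr rfl fun i _ => ?_
    rw [H.proj_blockScale, inner_smul_right, real_inner_self_eq_norm_sq]
  rw [h1] at hst
  rw [← hst, ← Finset.sum_sub_distrib]
  refine Finset.sum_congr rfl fun i hi => ?_
  rw [H.row_blockScale S x (Finset.mem_range.1 hi), inner_add_right, inner_add_right,
    inner_smul_right, inner_smul_right, inner_smul_right, real_inner_self_eq_norm_sq]
  simp only [hS, inner_add_right, inner_smul_right]
  simp only [← Finset.sum_sub_distrib, Finset.sum_mul, ← Finset.sum_add_distrib]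
  refine Finset.sum_congr rfl fun k _ => ?_
  ring

theorem le_of_tapered_windows (H : BlockTridiag N P T (r * ρL) (r * ρU)) (hr : 0 < r)
    (hL : 0 ≤ ρL) (hU : 0 ≤ ρU) (hs : ρL + ρU = 1) {ν s h : ℝ} {x : E} (hx : ‖x‖ = 1)
    (hTx : ‖T x‖ = ν) (hmin : ∀ z, ν * ‖z‖ ≤ ‖T z‖) (hh : 0 < h) {M : ℕ} {W : ℕ → ℕ → ℝ}
    {e : ℕ → ℕ} (hend : ∀ k < M, ∀ i, e k ≤ i → W k i = 0)
    (htest : ∀ k < M, s ^ 2 * ‖blockScale N P (W k) x‖ ^ 2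
      ≤ ∑ i ∈ Finset.range N, if i < e k then ‖P i (T (blockScale N P (W k) x))‖ ^ 2 else 0)
    (hmass : ∀ j, j + 1 < N → ∑ k ∈ Finset.range M, W k j ^ 2
      ≤ ∑ k ∈ Finset.range M, W k (j + 1) ^ 2)
    (hbal : ∀ j < N, ρL * (∑ k ∈ Finset.range M,
          if j + 1 < e k then (W k (j + 1) - W k j) ^ 2 else 0)
        + ρU * (∑ k ∈ Finset.range M, (W k j - W k (j - 1)) ^ 2)
      ≤ 4 * h ^ 2 * ∑ k ∈ Finset.range M, W k j ^ 2)
    (hsq : ∀ j < N, 1 + (∑ k ∈ Finset.range M, (W k (j + 1) - W k j) ^ 2) ^ 2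
      ≤ 8 * h * ∑ k ∈ Finset.range M, W k j ^ 2) :
    s ≤ ν + 2 * r * h := by
  have hν : 0 ≤ ν := hTx ▸ norm_nonneg _
  set S : ℕ → ℝ := fun i => ∑ k ∈ Finset.range M, W k i ^ 2 with hS
  set D : ℕ → ℝ := fun i => ∑ k ∈ Finset.range M, (W k i - W k (i - 1)) ^ 2 with hD
  set ξ : ℕ → ℝ := fun i => ‖P i x‖ with hξ
  set X : ℝ := ∑ i ∈ Finset.range N, S i * ξ i ^ 2 with hX
  have hD0 : D 0 = 0 := by simp [hD]
  have hDnn (i : ℕ) : 0 ≤ D i := Finset.sum_nonneg fun _ _ => sq_nonneg _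
  have hξN : ξ N = 0 := by simp [hξ, H.proj_ge N x le_rfl]
  have hξsum : ∑ i ∈ Finset.range N, ξ i ^ 2 = 1 := by
    rw [← H.norm_sq_eq_sum, hx, one_pow]
  have hysum : ∑ i ∈ Finset.range N, ‖P i (T x)‖ ^ 2 = ν ^ 2 := by
    rw [← H.norm_sq_eq_sum, hTx]
  have hDsq (j : ℕ) (hj : j < N) : 1 + (ρL * D (j + 1) ^ 2 + ρU * D j ^ 2) ≤ 8 * h * S j := by
    have h1 : 1 + D (j + 1) ^ 2 ≤ 8 * h * S j := hsq j hj
    have h2 : 1 + D j ^ 2 ≤ 8 * h * S j := by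
      rcases Nat.eq_zero_or_pos j with rfl | hpos
      · rw [hD0]; nlinarith [sq_nonneg (D (0 + 1))]
      · obtain ⟨i, rfl⟩ : ∃ i, j = i + 1 := ⟨j - 1, by omega⟩
        have h3 : 1 + D (i + 1) ^ 2 ≤ 8 * h * S i := hsq i (by omega)
        exact h3.trans (mul_le_mul_of_nonneg_left (hmass i hj) (by positivity))
    have e : 8 * h * S j = ρL * (8 * h * S j) + ρU * (8 * h * S j) := by
      rw [← add_mul, hs, one_mul]
    have := mul_le_mul_of_nonneg_left h1 hL
    have := mul_le_mul_of_nonneg_left h2 hU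
    linarith
  have hXpos : 0 < X := by
    have : 1 ≤ 8 * h * X := by
      rw [hX, Finset.mul_sum, ← hξsum]
      refine Finset.sum_le_sum fun i hi => ?_
      have h1 := hDsq i (Finset.mem_range.1 hi)
      have h2 : 0 ≤ ρL * D (i + 1) ^ 2 + ρU * D i ^ 2 := by positivity
      nlinarith [mul_nonneg (by linarith : 0 ≤ 8 * h * S i - 1) (sq_nonneg (ξ i))]
    by_contra hcon
    nlinarith [mul_nonneg hh.le (sub_nonneg.2 (not_lt.1 hcon))]
  have hcross : - ∑ i ∈ Finset.range N, (D i * inner ℝ (P i (T x)) (lowerPart P T x i)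
      + D (i + 1) * inner ℝ (P i (T x)) (P i (T (P (i + 1) x)))) ≤ 4 * h * r * ν * X := by
    rcases hν.eq_or_lt with h0 | hpos
    · have hTx0 : T x = 0 := by rw [← norm_eq_zero, hTx, h0]
      simp [hTx0, ← h0]
    · have hterm (i : ℕ) : 2 * ν * -(D i * inner ℝ (P i (T x)) (lowerPart P T x i)
          + D (i + 1) * inner ℝ (P i (T x)) (P i (T (P (i + 1) x))))
          ≤ r * (‖P i (T x)‖ ^ 2 + ν ^ 2 * (ρL * D i ^ 2 * ξ (i - 1) ^ 2
            + ρU * D (i + 1) ^ 2 * ξ (i + 1) ^ 2)) := by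
        have aux {d ρ z : ℝ} {v : E} (hd : 0 ≤ d) (hρ : 0 ≤ ρ) (hv : ‖v‖ ≤ r * ρ * z) :
            2 * ν * -(d * inner ℝ (P i (T x)) v)
              ≤ r * (ρ * (‖P i (T x)‖ ^ 2 + ν ^ 2 * (d ^ 2 * z ^ 2))) := by
          have h1 : - inner ℝ (P i (T x)) v ≤ ‖P i (T x)‖ * ‖v‖ :=
            (neg_le_abs _).trans (abs_real_inner_le_norm _ _)
          have h2 : - inner ℝ (P i (T x)) v ≤ ‖P i (T x)‖ * (r * ρ * z) :=
            h1.trans (mul_le_mul_of_nonneg_left hv (norm_nonneg _))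
          have h3 := mul_le_mul_of_nonneg_left h2 (by positivity : 0 ≤ 2 * ν * d)
          have h4 := mul_nonneg (mul_nonneg hr.le hρ) (sq_nonneg (‖P i (T x)‖ - ν * (d * z)))
          linarith
        have h1 := aux (hDnn i) hL (H.norm_lowerPart_le (mul_nonneg hr.le hL) x i)
        have h2 := aux (hDnn (i + 1)) hU (H.upper i x)
        have e : ‖P i (T x)‖ ^ 2 = ρL * ‖P i (T x)‖ ^ 2 + ρU * ‖P i (T x)‖ ^ 2 := by
          rw [← add_mul, hs, one_mul]
        rw [e]
        linarith
      have hsum := Finset.sum_le_sum fun i (_ : i ∈ Finset.range N) => hterm i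
      have hsplit : ∑ i ∈ Finset.range N, (‖P i (T x)‖ ^ 2 + ν ^ 2 * (ρL * D i ^ 2 * ξ (i - 1) ^ 2
          + ρU * D (i + 1) ^ 2 * ξ (i + 1) ^ 2))
          = ν ^ 2 + ν ^ 2 * ∑ i ∈ Finset.range N, (ρL * D i ^ 2 * ξ (i - 1) ^ 2
            + ρU * D (i + 1) ^ 2 * ξ (i + 1) ^ 2) := by
        rw [Finset.sum_add_distrib, ← Finset.mul_sum, hysum]
      rw [← Finset.mul_sum, ← Finset.mul_sum, Finset.sum_neg_distrib, hsplit] at hsum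
      have hshift := sum_neighbor_le (N := N) (p := fun i => ρL * D i ^ 2)
        (q := fun i => ρU * D i ^ 2) (ξ := ξ) (fun i => by positivity) (by simp [hD0])
        (by simp [hD0]) hξN
      have hbound : 1 + ∑ j ∈ Finset.range N, (ρL * D (j + 1) ^ 2 + ρU * D j ^ 2) * ξ j ^ 2
          ≤ 8 * h * X := by
        rw [hX, Finset.mul_sum, ← hξsum, ← Finset.sum_add_distrib]
        refine Finset.sum_le_sum fun i hi => ?_
        have h1 := mul_le_mul_of_nonneg_right (hDsq i (Finset.mem_range.1 hi)) (sq_nonneg (ξ i))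
        linarith
      have h5 := mul_le_mul_of_nonneg_left (add_le_add_right hshift 1)
        (by positivity : 0 ≤ r * ν ^ 2)
      have h6 := mul_le_mul_of_nonneg_left hbound (by positivity : 0 ≤ r * ν ^ 2)
      have h7 : 2 * ν * - ∑ i ∈ Finset.range N,
          (D i * inner ℝ (P i (T x)) (lowerPart P T x i)
            + D (i + 1) * inner ℝ (P i (T x)) (P i (T (P (i + 1) x))))
          ≤ 2 * ν * (4 * h * r * ν * X) := by linarith
      exact le_of_mul_le_mul_left h7 (by positivity)
  have hoff : ∑ i ∈ Finset.range N, ∑ k ∈ Finset.range M,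
      (if i < e k then ‖(W k (i - 1) - W k i) • lowerPart P T x i
        + (W k (i + 1) - W k i) • P i (T (P (i + 1) x))‖ ^ 2 else 0)
      ≤ r ^ 2 * (4 * h ^ 2 * X) := by
    set p : ℕ → ℝ := fun i =>
      ρL * ∑ k ∈ Finset.range M, if i < e k then (W k i - W k (i - 1)) ^ 2 else 0 with hp
    have hpnn (i : ℕ) : 0 ≤ p i := by
      refine mul_nonneg hL (Finset.sum_nonneg fun k _ => ?_)
      split_ifs <;> positivity
    have hshift := sum_neighbor_le (N := N) (p := p)
        (q := fun i => ρU * D i) (ξ := ξ) hpnn (by simp [hp])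
        (by simp [hD0]) hξN
    have hrow (i : ℕ) : ∑ k ∈ Finset.range M,
        (if i < e k then ‖(W k (i - 1) - W k i) • lowerPart P T x i
          + (W k (i + 1) - W k i) • P i (T (P (i + 1) x))‖ ^ 2 else 0)
        ≤ r ^ 2 * (p i * ξ (i - 1) ^ 2 + ρU * D (i + 1) * ξ (i + 1) ^ 2) := by
      have : r ^ 2 * (p i * ξ (i - 1) ^ 2 + ρU * D (i + 1) * ξ (i + 1) ^ 2)
          = ∑ k ∈ Finset.range M, r ^ 2 * (ρL * (if i < e k then (W k i - W k (i - 1)) ^ 2 else 0)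
            * ξ (i - 1) ^ 2 + ρU * (W k (i + 1) - W k i) ^ 2 * ξ (i + 1) ^ 2) := by
        simp only [hp, hD, Finset.mul_sum, Finset.sum_mul, ← Finset.sum_add_distrib,
          Nat.add_sub_cancel]
      rw [this]
      refine Finset.sum_le_sum fun k _ => ?_
      split_ifs with hik
      · refine (H.norm_offdiag_sq_le hr.le hL hU hs x _ _ i).trans (le_of_eq ?_)
        simp only [hξ]; ring
      · positivity
    refine (Finset.sum_le_sum fun i _ => hrow i).trans ?_
    rw [← Finset.mul_sum]
    refine mul_le_mul_of_nonneg_left (hshift.trans ?_) (sq_nonneg r)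
    rw [hX, Finset.mul_sum]
    refine Finset.sum_le_sum fun j hj => ?_
    have := mul_le_mul_of_nonneg_right (hbal j (Finset.mem_range.1 hj)) (sq_nonneg (ξ j))
    simp only [hp, Nat.add_sub_cancel]
    linarith
  have htotal : s ^ 2 * X ≤ (ν + 2 * r * h) ^ 2 * X := by
    have h1 : s ^ 2 * X = ∑ k ∈ Finset.range M, s ^ 2 * ‖blockScale N P (W k) x‖ ^ 2 := by
      simp only [H.norm_blockScale_sq, hX, hS, Finset.mul_sum, Finset.sum_mul]
      rw [Finset.sum_comm]
    have h2 := Finset.sum_le_sum fun k (hk : k ∈ Finset.range M) =>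
      htest k (Finset.mem_range.1 hk)
    rw [← h1, Finset.sum_comm] at h2
    refine h2.trans ?_
    have h3 : ∑ i ∈ Finset.range N, ∑ k ∈ Finset.range M,
        (if i < e k then ‖P i (T (blockScale N P (W k) x))‖ ^ 2 else 0)
        = ∑ i ∈ Finset.range N, ∑ k ∈ Finset.range M, (W k i ^ 2 * ‖P i (T x)‖ ^ 2
          + 2 * (W k i * inner ℝ (P i (T x)) ((W k (i - 1) - W k i) • lowerPart P T x i
          + (W k (i + 1) - W k i) • P i (T (P (i + 1) x)))))
        + ∑ i ∈ Finset.range N, ∑ k ∈ Finset.range M,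
          (if i < e k then ‖(W k (i - 1) - W k i) • lowerPart P T x i
            + (W k (i + 1) - W k i) • P i (T (P (i + 1) x))‖ ^ 2 else 0) := by
      rw [← Finset.sum_add_distrib]
      refine Finset.sum_congr rfl fun i hi => ?_
      rw [← Finset.sum_add_distrib]
      refine Finset.sum_congr rfl fun k hk => ?_
      split_ifs with hik
      · rw [H.row_blockScale _ x (Finset.mem_range.1 hi), norm_add_sq_real, inner_smul_left,
          norm_smul, mul_pow, Real.norm_eq_abs, sq_abs]
        simp
      · rw [hend k (Finset.mem_range.1 hk) i (not_lt.1 hik)]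
        simp
    rw [h3, H.sum_cross_eq hx hTx hmin]
    have h4 : (ν + 2 * r * h) ^ 2 * X = ν ^ 2 * X + 4 * h * r * ν * X + r ^ 2 * (4 * h ^ 2 * X) := by
      ring
    rw [h4, sub_eq_add_neg]
    exact add_le_add (add_le_add_right hcross _) hoff
  have h9 := le_of_mul_le_mul_right htotal hXpos
  exact (le_abs_self s).trans (abs_le_of_sq_le_sq h9 (by positivity))

end BlockTridiag

end

section

lemma sum_range_ite_reflect (g : ℕ → ℝ) {j M : ℕ} (h : j ≤ M) :
    ∑ k ∈ Finset.range M, (if k < j then g (j - 1 - k) else 0) = ∑ q ∈ Finset.range j, g q := by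
  rw [← Finset.sum_range_reflect g j,
    ← Finset.sum_subset (Finset.range_mono h) fun k _ hk => if_neg (by simpa using hk)]
  exact Finset.sum_congr rfl fun k hk => if_pos (Finset.mem_range.1 hk)

/-- The family of window weights: a left taper followed by translates of the half-sine weight. -/
def taperWeight (t : ℝ) (n : ℕ) : ℕ → ℕ → ℝ
  | 0, i => leftTaper t n i
  | k + 1, i => if k < i then halfSine t n (i - 1 - k) else 0

section TaperWeight

variable {t : ℝ} {n M j : ℕ}

lemma taperWeight_succ_sub (k : ℕ) :
    taperWeight t n (k + 1) (j + 1) - taperWeight t n (k + 1) j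
      = if k < j + 1 then halfSineStep t n (j + 1 - 1 - k) else 0 := by
  simp only [taperWeight, halfSineStep]
  rcases lt_trichotomy k j with h | rfl | h
  · have h1 : j + 1 - 1 - k ≠ 0 := by omega
    have h2 : j + 1 - 1 - k - 1 = j - 1 - k := by omega
    rw [if_pos (by omega), if_pos h, if_pos (by omega), if_neg h1, h2]
  · simp
  · rw [if_neg (by omega), if_neg (by omega), if_neg (by omega), sub_zero]

lemma sum_taperWeight_sq (hj : j ≤ M) :
    ∑ k ∈ Finset.range (M + 1), taperWeight t n k j ^ 2 = taperMass t n j := by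
  rw [Finset.sum_range_succ', taperMass, add_comm,
    ← sum_range_ite_reflect (fun q => halfSine t n q ^ 2) hj]
  simp [taperWeight, ite_pow]

lemma sum_taperWeight_sub_sq (hj : j < M) :
    ∑ k ∈ Finset.range (M + 1), (taperWeight t n k (j + 1) - taperWeight t n k j) ^ 2
      = taperEnergy t n j := by
  rw [Finset.sum_range_succ', taperEnergy, add_comm,
    ← sum_range_ite_reflect (fun q => halfSineStep t n q ^ 2) (Nat.succ_le_of_lt hj)]
  simp only [taperWeight_succ_sub, ite_pow]
  simp [taperWeight]

lemma sum_taperWeight_sub_sq_ite (hj : j < M) :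
    ∑ k ∈ Finset.range (M + 1),
        (if j + 1 < k + n then (taperWeight t n k (j + 1) - taperWeight t n k j) ^ 2 else 0)
      = (if j + 1 < n then (leftTaper t n (j + 1) - leftTaper t n j) ^ 2 else 0)
        + ∑ q ∈ Finset.range (min (j + 1) n), halfSineStep t n q ^ 2 := by
  have h1 : ∑ q ∈ Finset.range (min (j + 1) n), halfSineStep t n q ^ 2
      = ∑ q ∈ Finset.range (j + 1), if q < n then halfSineStep t n q ^ 2 else 0 := by
    rw [← Finset.sum_filter]
    refine Finset.sum_congr ?_ fun _ _ => rfl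
    ext q; simp
  rw [h1, Finset.sum_range_succ', add_comm,
    ← sum_range_ite_reflect (fun q => if q < n then halfSineStep t n q ^ 2 else 0)
      (Nat.succ_le_of_lt hj)]
  congr 1
  · simp [taperWeight]
  · refine Finset.sum_congr rfl fun k _ => ?_
    rw [taperWeight_succ_sub]
    by_cases hk : k < j + 1
    · have : (j + 1 < k + 1 + n) ↔ (j + 1 - 1 - k < n) := by omega
      simp only [hk, this, if_true, Nat.succ_eq_add_one]
    · simp [hk]

lemma taperWeight_eq_zero {k i : ℕ} (h : i < k ∨ k + n ≤ i) : taperWeight t n k i = 0 := by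
  cases k with
  | zero => exact leftTaper_of_le (by omega)
  | succ k =>
    simp only [taperWeight]
    split_ifs with hk
    · rw [halfSine, if_neg (by omega)]
    · rfl

end TaperWeight

variable {E : Type*} [NormedAddCommGroup E] [InnerProductSpace ℝ E]

namespace BlockTridiag

variable {N n : ℕ} {P : ℕ → E →ₗ[ℝ] E} {T : E →ₗ[ℝ] E}

lemma window_test {l u s : ℝ} (H : BlockTridiag N P T l u) (HW : WindowBound N n P T s)
    (hnN : n ≤ N) {k : ℕ} {w : ℕ → ℝ} (hw : ∀ i, i < k ∨ k + n ≤ i → w i = 0) (x : E) :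
    s ^ 2 * ‖blockScale N P w x‖ ^ 2
      ≤ ∑ i ∈ Finset.range N, if i < k + n then ‖P i (T (blockScale N P w x))‖ ^ 2 else 0 := by
  refine (HW (min k (N - n)) (by omega) _ fun i hi => ?_).trans ?_
  · by_cases hiN : i < N
    · rw [H.proj_blockScale, hw i (by omega), zero_smul]
    · exact H.proj_ge i _ (not_lt.1 hiN)
  · rw [← Finset.sum_filter]
    refine Finset.sum_le_sum_of_subset_of_nonneg ?_ fun _ _ _ => sq_nonneg _
    intro i hi
    simp at hi ⊢
    omega

variable {r ρL ρU : ℝ}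

theorem le_of_large_angle (H : BlockTridiag N P T (r * ρL) (r * ρU)) (hr : 0 < r)
    (hL : 0 ≤ ρL) (hU : 0 ≤ ρU) (hs : ρL + ρU = 1) {ν s t : ℝ} {x : E} (hx : ‖x‖ = 1)
    (hTx : ‖T x‖ = ν) (hmin : ∀ z, ν * ‖z‖ ≤ ‖T z‖) (HW : WindowBound N n P T s)
    (hn3 : 3 ≤ n) (hnN : n ≤ N) (ht0 : 0 < t) (ht : t ≤ π / 3) (hn : 3 * π / 4 ≤ n * t)
    (hn1 : n * t ≤ π) (hw : Real.sin ((n + 1 / 2) * t) ≤ ρL * Real.sin ((n - 1 / 2) * t)) :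
    s ≤ ν + 2 * r * Real.sin (t / 2) := by
  refine H.le_of_tapered_windows hr hL hU hs hx hTx hmin
    (Real.sin_pos_of_pos_of_lt_pi (by linarith) (by linarith [Real.pi_pos]))
    (M := N + 1) (W := taperWeight t n) (e := fun k => k + n)
    (fun k _ i hi => taperWeight_eq_zero (Or.inr hi))
    (fun k _ => H.window_test HW hnN (fun i hi => taperWeight_eq_zero hi) x) ?_ ?_ ?_
  · intro j hj
    rw [sum_taperWeight_sq (by omega), sum_taperWeight_sq (by omega)]
    exact taperMass_le_succ ht0 ht hn hn1 j
  · intro j hj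
    rw [sum_taperWeight_sq hj.le, sum_taperWeight_sub_sq_ite hj]
    refine le_trans (le_of_eq ?_) (taper_energy_balance hL hU hs ht0 ht hn hn1 hw j)
    congr 2
    split_ifs with h0
    · simp [h0]
    · obtain ⟨i, rfl⟩ : ∃ i, j = i + 1 := ⟨j - 1, by omega⟩
      exact sum_taperWeight_sub_sq (by omega)
  · intro j hj
    rw [sum_taperWeight_sq hj.le, sum_taperWeight_sub_sq hj]
    exact taper_energy_sq_le hn3 ht0 ht hn hn1 j

end BlockTridiag

end

section

variable {E : Type*} [NormedAddCommGroup E] [InnerProductSpace ℝ E]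

lemma add_mul_sq_sub_le {s u F ζ : ℝ} (hus : u ^ 2 < s ^ 2) :
    (F + u * ζ) ^ 2 - s ^ 2 * ζ ^ 2 ≤ s ^ 2 / (s ^ 2 - u ^ 2) * F ^ 2 := by
  have hpos : 0 < s ^ 2 - u ^ 2 := by linarith
  rw [div_mul_eq_mul_div, le_div_iff₀ hpos]
  nlinarith [sq_nonneg (u * F - (s ^ 2 - u ^ 2) * ζ)]

namespace BlockTridiag

variable {N n : ℕ} {P : ℕ → E →ₗ[ℝ] E} {T : E →ₗ[ℝ] E} {l u s : ℝ}

lemma proj_map_eq_zero (H : BlockTridiag N P T l u) {i K : ℕ} {z : E} (hi : i < K)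
    (hz : ∀ j, j ≤ K → P j z = 0) : P i (T z) = 0 := by
  by_cases hiN : i < N
  · rw [H.row_eq z hiN, lowerPart, hz i hi.le, hz (i + 1) hi, hz (i - 1) (by omega)]
    simp
  · exact H.proj_ge i _ (not_lt.1 hiN)

lemma proj_map_edge (H : BlockTridiag N P T l u) {K : ℕ} {z : E}
    (hz : ∀ j, j ≤ K → P j z = 0) : P K (T z) = P K (T (P (K + 1) z)) := by
  by_cases hKN : K < N
  · rw [H.row_eq z hKN, lowerPart, hz K le_rfl, hz (K - 1) (by omega)]
    simp
  · rw [H.proj_ge K _ (not_lt.1 hKN), H.proj_ge K _ (not_lt.1 hKN)]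

/-- Elimination of the blocks to the right of block `K` inside the first window. -/
lemma exists_eliminating [FiniteDimensional ℝ E] (H : BlockTridiag N P T l u)
    (HW : WindowBound N n P T s) (hnN : n ≤ N) (hu : 0 ≤ u) (hus : u < s) {K : ℕ}
    (hK : K + 1 < n) (v : E) :
    ∃ z, (∀ i, i ≤ K ∨ n ≤ i → P i z = 0) ∧
      ∀ i, K + 1 ≤ i → i < n → P i (T (v + z)) = 0 := by
  set Q : E →ₗ[ℝ] E := ∑ i ∈ Finset.Ico (K + 1) n, P i with hQ
  have hPQ_in (i : ℕ) (h1 : K + 1 ≤ i) (h2 : i < n) (y : E) : P i (Q y) = P i y := by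
    rw [hQ, LinearMap.sum_apply, map_sum, Finset.sum_eq_single i, H.proj_self]
    · intro j _ hj; exact H.proj_ne i j y hj.symm
    · intro h; exact absurd (Finset.mem_Ico.2 ⟨h1, h2⟩) h
  have hPQ_out (i : ℕ) (h : i ≤ K ∨ n ≤ i) (y : E) : P i (Q y) = 0 := by
    rw [hQ, LinearMap.sum_apply, map_sum]
    refine Finset.sum_eq_zero fun j hj => H.proj_ne i j y ?_
    have := Finset.mem_Ico.1 hj
    omega
  have hQapp (y : E) : Q y = ∑ i ∈ Finset.Ico (K + 1) n, P i y := by rw [hQ, LinearMap.sum_apply]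
  have hQQ (y : E) : Q (Q y) = Q y := by
    rw [hQapp (Q y), hQapp y]
    refine Finset.sum_congr rfl fun i hi => ?_
    rw [← hQapp y]
    exact hPQ_in i (Finset.mem_Ico.1 hi).1 (Finset.mem_Ico.1 hi).2 y
  have hinj0 (z : E) (hz : Q z = z) (hTz : Q (T z) = 0) : z = 0 := by
    have hout (i : ℕ) (h : i ≤ K ∨ n ≤ i) : P i z = 0 := by rw [← hz]; exact hPQ_out i h z
    have hwin := HW 0 (by omega) z fun i hi => hout i (by omega)
    have hsum : ∑ i ∈ Finset.Ico 0 (0 + n), ‖P i (T z)‖ ^ 2 = ‖P K (T z)‖ ^ 2 := by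
      rw [Finset.sum_eq_single_of_mem K (by simp; omega)]
      intro i hi hne
      rcases lt_or_gt_of_ne hne with h | h
      · rw [H.proj_map_eq_zero h fun j hj => hout j (Or.inl hj)]; simp
      · rw [← hPQ_in i (by omega) (by simpa using hi), hTz]; simp
    rw [hsum, H.proj_map_edge fun j hj => hout j (Or.inl hj)] at hwin
    have h1 : ‖P K (T (P (K + 1) z))‖ ≤ u * ‖z‖ :=
      (H.upper K z).trans (mul_le_mul_of_nonneg_left (H.norm_proj_le _ z) hu)
    have h2 := pow_le_pow_left₀ (norm_nonneg _) h1 2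
    rw [mul_pow] at h2
    have h3 : u ^ 2 < s ^ 2 := pow_lt_pow_left₀ hus hu two_ne_zero
    by_contra hne
    have h4 : 0 < ‖z‖ ^ 2 := by have := norm_pos_iff.2 hne; positivity
    nlinarith [mul_pos (sub_pos.2 h3) h4]
  set G : E →ₗ[ℝ] E := Q ∘ₗ T ∘ₗ Q + (LinearMap.id - Q) with hG
  have hGapp (y : E) : G y = Q (T (Q y)) + (y - Q y) := by simp [hG]
  have hinj : Function.Injective G := by
    refine (injective_iff_map_eq_zero G).2 fun y hy => ?_
    rw [hGapp] at hy
    have h1 := congrArg Q hy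
    rw [map_add, map_sub, hQQ, hQQ, sub_self, add_zero, map_zero] at h1
    rw [h1, zero_add, sub_eq_zero] at hy
    exact hinj0 y hy.symm (by rw [← hy] at h1; exact h1)
  obtain ⟨y, hy⟩ := LinearMap.surjective_of_injective hinj (- Q (T v))
  rw [hGapp] at hy
  have hQy : Q (T (Q y)) = - Q (T v) := by
    have h1 := congrArg Q hy
    rwa [map_add, map_sub, hQQ, hQQ, sub_self, add_zero, map_neg, hQQ] at h1
  refine ⟨Q y, fun i hi => hPQ_out i hi y, fun i h1 h2 => ?_⟩
  rw [← hPQ_in i h1 h2, map_add, map_add, hQy, add_neg_cancel, map_zero]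

lemma triangular_test [FiniteDimensional ℝ E] (H : BlockTridiag N P T l u)
    (HW : WindowBound N n P T s) (hnN : n ≤ N) (hu : 0 ≤ u) (hus : u < s) {K : ℕ}
    (hK : K + 1 < n) {v : E} (hv : ∀ i, K < i → P i v = 0) :
    s ^ 2 * ‖v‖ ^ 2 ≤ ∑ i ∈ Finset.range K, ‖P i (T v)‖ ^ 2
      + s ^ 2 / (s ^ 2 - u ^ 2) * ‖P K (T v)‖ ^ 2 := by
  obtain ⟨z, hz, hvz⟩ := H.exists_eliminating HW hnN hu hus hK v
  have hwin := HW 0 (by omega) (v + z) fun i hi => by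
    rw [map_add, hv i (by omega), hz i (by omega), add_zero]
  have hnorm : ‖v + z‖ ^ 2 = ‖v‖ ^ 2 + ‖z‖ ^ 2 := by
    rw [norm_add_sq_real, H.inner_eq_sum, Finset.sum_eq_zero]
    · ring
    · intro i _
      rcases le_or_gt i K with h | h
      · rw [hz i (Or.inl h), inner_zero_right]
      · rw [hv i h, inner_zero_left]
  have hsum : ∑ i ∈ Finset.Ico 0 (0 + n), ‖P i (T (v + z))‖ ^ 2
      = ∑ i ∈ Finset.range K, ‖P i (T v)‖ ^ 2 + ‖P K (T (v + z))‖ ^ 2 := by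
    rw [zero_add, ← Finset.range_eq_Ico,
      ← Finset.sum_subset (Finset.range_mono hK.le) fun i hi hni => by
        rw [hvz i (by simpa using hni) (Finset.mem_range.1 hi)]; simp,
      Finset.sum_range_succ]
    congr 1
    refine Finset.sum_congr rfl fun i hi => ?_
    rw [map_add, map_add,
      H.proj_map_eq_zero (Finset.mem_range.1 hi) fun j hj => hz j (Or.inl hj), add_zero]
  have hedge : ‖P K (T (v + z))‖ ≤ ‖P K (T v)‖ + u * ‖z‖ := by
    rw [map_add, map_add, H.proj_map_edge (z := z) fun j hj => hz j (Or.inl hj)]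
    refine (norm_add_le _ _).trans (add_le_add_right ?_ _)
    exact (H.upper K z).trans (mul_le_mul_of_nonneg_left (H.norm_proj_le _ z) hu)
  have hedge2 := pow_le_pow_left₀ (norm_nonneg _) hedge 2
  have := add_mul_sq_sub_le (F := ‖P K (T v)‖) (ζ := ‖z‖)
    (pow_lt_pow_left₀ hus hu two_ne_zero)
  rw [hnorm, hsum] at hwin
  linarith

end BlockTridiag

end

section

lemma mul_norm_add_sq_le {E : Type*} [SeminormedAddCommGroup E] {ν ε : ℝ} (hν : 0 < ν) (hε : 0 < ε)
    (a b : E) :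
    ε * ‖a + b‖ ^ 2 ≤ (ν + ε) * (ε * (ν⁻¹ * ‖a‖ ^ 2) + ‖b‖ ^ 2) := by
  have h1 := pow_le_pow_left₀ (norm_nonneg _) (norm_add_le a b) 2
  have h2 := mul_le_mul_of_nonneg_left h1 hε.le
  refine h2.trans ?_
  have h3 : (ν + ε) * (ε * (ν⁻¹ * ‖a‖ ^ 2) + ‖b‖ ^ 2) - ε * (‖a‖ + ‖b‖) ^ 2
      = ν⁻¹ * (ε * ‖a‖ - ν * ‖b‖) ^ 2 := by
    field_simp
    ring
  have : 0 ≤ ν⁻¹ * (ε * ‖a‖ - ν * ‖b‖) ^ 2 := by positivity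
  linarith

variable {E : Type*} [NormedAddCommGroup E] [InnerProductSpace ℝ E]

lemma norm_smul_add_smul_sq_le_two {a b r ρL ρU ξ η : ℝ} {v w : E}
    (hv : ‖v‖ ≤ r * ρL * ξ) (hw : ‖w‖ ≤ r * ρU * η) :
    ‖a • v + b • w‖ ^ 2 ≤ r ^ 2 * (2 * ρL ^ 2 * a ^ 2 * ξ ^ 2 + 2 * ρU ^ 2 * b ^ 2 * η ^ 2) := by
  have h1 : ‖a • v + b • w‖ ≤ |a| * (r * ρL * ξ) + |b| * (r * ρU * η) := by
    refine (norm_add_le _ _).trans ?_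
    rw [norm_smul, norm_smul, Real.norm_eq_abs, Real.norm_eq_abs]
    exact add_le_add (mul_le_mul_of_nonneg_left hv (abs_nonneg a))
      (mul_le_mul_of_nonneg_left hw (abs_nonneg b))
  have h2 := pow_le_pow_left₀ (norm_nonneg _) h1 2
  refine h2.trans ?_
  rw [← sq_abs a, ← sq_abs b]
  nlinarith [sq_nonneg (|a| * (r * ρL * ξ) - |b| * (r * ρU * η))]

/-- Row weights that amplify row `K` and discard all later rows. -/
def rowWeight (c : ℝ) (K i : ℕ) : ℝ := if i < K then 1 else if i = K then c else 0

lemma rowWeight_nonneg {c : ℝ} (hc : 0 ≤ c) (K i : ℕ) : 0 ≤ rowWeight c K i := by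
  unfold rowWeight; split_ifs <;> linarith

lemma sum_rowWeight_mul (c : ℝ) (g : ℕ → ℝ) {i M : ℕ} (hi : i < M) :
    ∑ K ∈ Finset.range M, rowWeight c K i * g K
      = ∑ K ∈ Finset.range M, (if i < K then g K else 0) + c * g i := by
  have h : ∀ K ∈ Finset.range M, rowWeight c K i * g K
      = (if i < K then g K else 0) + (if i = K then c * g K else 0) := by
    intro K _
    unfold rowWeight
    rcases lt_trichotomy i K with h | rfl | h
    · simp [h, h.ne]
    · simp
    · simp [h.not_gt, h.ne']
  rw [Finset.sum_congr rfl h, Finset.sum_add_distrib, Finset.sum_ite_eq]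
  simp [hi]

namespace BlockTridiag

variable {N : ℕ} {P : ℕ → E →ₗ[ℝ] E} {T : E →ₗ[ℝ] E} {r ρL ρU : ℝ}

theorem amplified_windows_le (H : BlockTridiag N P T (r * ρL) (r * ρU)) (hr : 0 < r)
    (hL : 0 ≤ ρL) (hU : 0 ≤ ρU) (hs : ρL + ρU = 1) {ν s ε c : ℝ} {x : E} (hx : ‖x‖ = 1)
    (hTx : ‖T x‖ = ν) (hε : 0 < ε) (hc : 0 ≤ c) {M : ℕ} (hNM : N ≤ M) {W : ℕ → ℕ → ℝ}
    {S w2 d2 eL eU : ℝ}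
    (hend : ∀ K i, K < i → W K i = 0)
    (htest : ∀ K < M, s ^ 2 * ‖blockScale N P (W K) x‖ ^ 2
      ≤ ∑ i ∈ Finset.range N, rowWeight c K i * ‖P i (T (blockScale N P (W K) x))‖ ^ 2)
    (hmass : ∀ i < N, ∑ K ∈ Finset.range M, W K i ^ 2 = S)
    (hlast : ∀ i, W i i ^ 2 = w2)
    (hlast_step : ∀ j, (W (j + 1) (j + 1) - W (j + 1) j) ^ 2 = d2)
    (hlower : ∀ j < N, ∑ K ∈ Finset.range M,
      (if j + 1 < K then (W K (j + 1) - W K j) ^ 2 else 0) = eL)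
    (hupper : ∀ j < N, ∑ K ∈ Finset.range M,
      (if j < K then (W K (j + 1) - W K j) ^ 2 else 0) = eU) :
    ε * (s ^ 2 * S) ≤ (ν + ε) * (ε * (ν * (S + (c - 1) * w2))
      + r ^ 2 * (ρL * eL + 2 * c * ρL ^ 2 * d2 + (ρU * eU + 2 * c * ρU ^ 2 * w2))) := by
  have hν : 0 ≤ ν := hTx ▸ norm_nonneg _
  have hξsum : ∑ i ∈ Finset.range N, ‖P i x‖ ^ 2 = 1 := by
    rw [← H.norm_sq_eq_sum, hx, one_pow]
  have hysum : ∑ i ∈ Finset.range N, ‖P i (T x)‖ ^ 2 = ν ^ 2 := by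
    rw [← H.norm_sq_eq_sum, hTx]
  have hw2 : 0 ≤ w2 := hlast 0 ▸ sq_nonneg _
  have hd2 : 0 ≤ d2 := hlast_step 0 ▸ sq_nonneg _
  have hN : 0 < N := by
    by_contra h
    have : N = 0 := by omega
    subst this
    simp at hξsum
  have heL : 0 ≤ eL := hlower 0 hN ▸ Finset.sum_nonneg fun _ _ => by split_ifs <;> positivity
  have heU : 0 ≤ eU := hupper 0 hN ▸ Finset.sum_nonneg fun _ _ => by split_ifs <;> positivity
  set C : ℕ → ℕ → E := fun K i => (W K (i - 1) - W K i) • lowerPart P T x i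
    + (W K (i + 1) - W K i) • P i (T (P (i + 1) x)) with hC
  have hrow (K i : ℕ) (hi : i < N) : ε * ‖P i (T (blockScale N P (W K) x))‖ ^ 2
      ≤ (ν + ε) * (ε * (ν⁻¹ * (W K i ^ 2 * ‖P i (T x)‖ ^ 2)) + ‖C K i‖ ^ 2) := by
    rw [H.row_blockScale _ x hi]
    rcases hν.eq_or_lt with h0 | hpos
    · have hTx0 : T x = 0 := by rw [← norm_eq_zero, hTx, h0]
      simp [hTx0, ← h0, hC]
    · have h1 := mul_norm_add_sq_le hpos hε (W K i • P i (T x)) (C K i)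
      rwa [norm_smul, mul_pow, Real.norm_eq_abs, sq_abs] at h1
  have hmass' (i : ℕ) (hi : i < N) :
      ∑ K ∈ Finset.range M, rowWeight c K i * W K i ^ 2 = S + (c - 1) * w2 := by
    rw [sum_rowWeight_mul c (fun K => W K i ^ 2) (hi.trans_le hNM), ← hmass i hi, ← hlast i]
    have h1 := sum_rowWeight_mul 1 (fun K => W K i ^ 2) (hi.trans_le hNM)
    have h2 : ∑ K ∈ Finset.range M, rowWeight 1 K i * W K i ^ 2
        = ∑ K ∈ Finset.range M, W K i ^ 2 := by
      refine Finset.sum_congr rfl fun K _ => ?_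
      rcases le_or_gt i K with h | h
      · rcases h.lt_or_eq with h' | h' <;> simp [rowWeight, h']
      · simp [hend K i h]
    rw [h2] at h1
    rw [h1]
    ring
  have hoff (i : ℕ) (hi : i < N) : ∑ K ∈ Finset.range M, rowWeight c K i * ‖C K i‖ ^ 2
      ≤ r ^ 2 * ((if i = 0 then 0 else ρL * eL + 2 * c * ρL ^ 2 * d2) * ‖P (i - 1) x‖ ^ 2
        + (ρU * eU + 2 * c * ρU ^ 2 * w2) * ‖P (i + 1) x‖ ^ 2) := by
    rw [sum_rowWeight_mul c (fun K => ‖C K i‖ ^ 2) (hi.trans_le hNM)]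
    have h1 : c * ‖C i i‖ ^ 2 ≤ c * (r ^ 2 * (2 * ρL ^ 2 * (W i (i - 1) - W i i) ^ 2
        * ‖P (i - 1) x‖ ^ 2 + 2 * ρU ^ 2 * w2 * ‖P (i + 1) x‖ ^ 2)) := by
      refine mul_le_mul_of_nonneg_left ?_ hc
      have := norm_smul_add_smul_sq_le_two (a := W i (i - 1) - W i i) (b := W i (i + 1) - W i i)
        (H.norm_lowerPart_le (mul_nonneg hr.le hL) x i) (H.upper i x)
      have hb : (W i (i + 1) - W i i) ^ 2 = w2 := by
        rw [hend i (i + 1) (by omega), zero_sub, neg_sq, hlast]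
      rwa [hb] at this
    have h2 : ∑ K ∈ Finset.range M, (if i < K then ‖C K i‖ ^ 2 else 0)
        ≤ r ^ 2 * (ρL * (∑ K ∈ Finset.range M,
          if i < K then (W K (i - 1) - W K i) ^ 2 else 0) * ‖P (i - 1) x‖ ^ 2
          + ρU * eU * ‖P (i + 1) x‖ ^ 2) := by
      rw [← hupper i hi]
      simp only [Finset.mul_sum, Finset.sum_mul, ← Finset.sum_add_distrib]
      refine Finset.sum_le_sum fun K _ => ?_
      split_ifs
      · exact H.norm_offdiag_sq_le hr.le hL hU hs x _ _ i
      · simp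
    refine (add_le_add h2 h1).trans (le_of_eq ?_)
    rcases Nat.eq_zero_or_pos i with rfl | hpos
    · simp
      ring
    · obtain ⟨j, rfl⟩ : ∃ j, i = j + 1 := ⟨i - 1, by omega⟩
      rw [if_neg (by omega), Nat.add_sub_cancel, ← neg_sub (W (j + 1) (j + 1)), neg_sq,
        hlast_step j, ← hlower j (by omega)]
      simp only [← neg_sub (W _ (j + 1)) (W _ j), neg_sq]
      ring
  have hneigh := sum_neighbor_le (N := N)
    (p := fun i => if i = 0 then 0 else ρL * eL + 2 * c * ρL ^ 2 * d2)
    (q := fun _ => ρU * eU + 2 * c * ρU ^ 2 * w2) (ξ := fun i => ‖P i x‖)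
    (fun i => by split_ifs <;> positivity) (by simp) (by positivity)
    (by simp [H.proj_ge N x le_rfl])
  simp only [Nat.add_eq_zero_iff, one_ne_zero, and_false, if_false] at hneigh
  rw [← Finset.mul_sum, hξsum, mul_one] at hneigh
  have hsum : ε * (s ^ 2 * S) ≤ ∑ i ∈ Finset.range N, ∑ K ∈ Finset.range M,
      rowWeight c K i * ((ν + ε) * (ε * (ν⁻¹ * (W K i ^ 2 * ‖P i (T x)‖ ^ 2)) + ‖C K i‖ ^ 2)) := by
    have h1 : s ^ 2 * S = ∑ K ∈ Finset.range M, s ^ 2 * ‖blockScale N P (W K) x‖ ^ 2 := by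
      simp only [H.norm_blockScale_sq, ← Finset.mul_sum]
      rw [Finset.sum_comm]
      simp only [← Finset.sum_mul]
      congr 1
      rw [Finset.sum_congr rfl fun i hi => by rw [hmass i (Finset.mem_range.1 hi)],
        ← Finset.mul_sum, hξsum, mul_one]
    have h2 := Finset.sum_le_sum fun K (hK : K ∈ Finset.range M) =>
      htest K (Finset.mem_range.1 hK)
    rw [← h1, Finset.sum_comm] at h2
    refine (mul_le_mul_of_nonneg_left h2 hε.le).trans ?_
    simp only [Finset.mul_sum]
    refine Finset.sum_le_sum fun i hi => Finset.sum_le_sum fun K _ => ?_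
    have := mul_le_mul_of_nonneg_left (hrow K i (Finset.mem_range.1 hi)) (rowWeight_nonneg hc K i)
    linarith
  refine hsum.trans ?_
  have hsplit : ∀ i ∈ Finset.range N, ∑ K ∈ Finset.range M,
      rowWeight c K i * ((ν + ε) * (ε * (ν⁻¹ * (W K i ^ 2 * ‖P i (T x)‖ ^ 2)) + ‖C K i‖ ^ 2))
      = (ν + ε) * (ε * (ν⁻¹ * ((S + (c - 1) * w2) * ‖P i (T x)‖ ^ 2))
        + ∑ K ∈ Finset.range M, rowWeight c K i * ‖C K i‖ ^ 2) := by
    intro i hi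
    rw [← hmass' i (Finset.mem_range.1 hi)]
    simp only [Finset.mul_sum, Finset.sum_mul, ← Finset.sum_add_distrib]
    exact Finset.sum_congr rfl fun K _ => by ring
  rw [Finset.sum_congr rfl hsplit, ← Finset.mul_sum, Finset.sum_add_distrib, ← Finset.mul_sum,
    ← Finset.mul_sum, ← Finset.mul_sum, hysum]
  refine mul_le_mul_of_nonneg_left (add_le_add (le_of_eq ?_) ?_) (by positivity)
  · rcases hν.eq_or_lt with h0 | hpos
    · simp [← h0]
    · field_simp
  · refine (Finset.sum_le_sum fun i hi => hoff i (Finset.mem_range.1 hi)).trans ?_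
    rw [← Finset.mul_sum]
    exact mul_le_mul_of_nonneg_left hneigh (sq_nonneg r)

end BlockTridiag

end

section

/-- Translates of the half-sine weight, indexed by the last block of their support. -/
def endWeight (t : ℝ) (n K i : ℕ) : ℝ := taperWeight t n (K + 1) (i + n)

section EndWeight

variable {t : ℝ} {n : ℕ}

lemma endWeight_eq_zero {K i : ℕ} (h : K < i ∨ i + n ≤ K) : endWeight t n K i = 0 :=
  taperWeight_eq_zero (by omega)

lemma endWeight_self (hn : 0 < n) (i : ℕ) : endWeight t n i i = halfSine t n (n - 1) := by
  rw [endWeight, taperWeight, if_pos (by omega)]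
  congr 1
  omega

lemma endWeight_succ_sub (K j : ℕ) : endWeight t n K (j + 1) - endWeight t n K j
    = if K < j + n + 1 then halfSineStep t n (j + n + 1 - 1 - K) else 0 := by
  rw [endWeight, endWeight, ← taperWeight_succ_sub, add_right_comm]

lemma sum_endWeight_sq {i M : ℕ} (h : i + n ≤ M) :
    ∑ K ∈ Finset.range M, endWeight t n K i ^ 2 = ∑ q ∈ Finset.range n, halfSine t n q ^ 2 := by
  rw [← sum_halfSine_sq_of_le (Nat.le_add_left n i),
    ← sum_range_ite_reflect (fun q => halfSine t n q ^ 2) h]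
  simp [endWeight, taperWeight, ite_pow]

lemma sum_endWeight_sub_sq_ite {j M a b : ℕ} (h : j + n + 1 ≤ M) (hab : a + b = j + n)
    (hb : b ≤ j + n) :
    ∑ K ∈ Finset.range M, (if a < K then (endWeight t n K (j + 1) - endWeight t n K j) ^ 2 else 0)
      = ∑ q ∈ Finset.range b, halfSineStep t n q ^ 2 := by
  have h1 : ∑ q ∈ Finset.range b, halfSineStep t n q ^ 2
      = ∑ q ∈ Finset.range (j + n + 1), if q < b then halfSineStep t n q ^ 2 else 0 := by
    rw [← Finset.sum_filter]
    refine Finset.sum_congr ?_ fun _ _ => rfl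
    ext q; simp; omega
  rw [h1, ← sum_range_ite_reflect (fun q => if q < b then halfSineStep t n q ^ 2 else 0) h]
  refine Finset.sum_congr rfl fun K _ => ?_
  rw [endWeight_succ_sub]
  by_cases hK : K < j + n + 1
  · have : a < K ↔ j + n + 1 - 1 - K < b := by omega
    simp only [hK, this, if_true]
  · simp [hK]

end EndWeight

lemma sum_rowWeight_row (c : ℝ) (g : ℕ → ℝ) {K N : ℕ} (hK : K < N) :
    ∑ i ∈ Finset.range N, rowWeight c K i * g i = ∑ i ∈ Finset.range K, g i + c * g K := by
  rw [← Finset.sum_subset (Finset.range_mono (Nat.succ_le_of_lt hK)) fun i _ hi => ?_,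
    Finset.sum_range_succ]
  · congr 1
    · refine Finset.sum_congr rfl fun i hi => ?_
      rw [rowWeight, if_pos (Finset.mem_range.1 hi), one_mul]
    · simp [rowWeight]
  · have : K < i := by simpa using hi
    simp [rowWeight, this.not_gt, this.ne']

variable {E : Type*} [NormedAddCommGroup E] [InnerProductSpace ℝ E]

namespace BlockTridiag

variable {N n : ℕ} {P : ℕ → E →ₗ[ℝ] E} {T : E →ₗ[ℝ] E} {r ρL ρU : ℝ}

lemma endWeight_test [FiniteDimensional ℝ E] {l u s t : ℝ} (H : BlockTridiag N P T l u)
    (HW : WindowBound N n P T s) (hnN : n ≤ N) (hu : 0 ≤ u) (hus : u < s) (K : ℕ) (x : E) :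
    s ^ 2 * ‖blockScale N P (endWeight t n K) x‖ ^ 2
      ≤ ∑ i ∈ Finset.range N, rowWeight (s ^ 2 / (s ^ 2 - u ^ 2)) K i
        * ‖P i (T (blockScale N P (endWeight t n K) x))‖ ^ 2 := by
  have hlt : u ^ 2 < s ^ 2 := pow_lt_pow_left₀ hus hu two_ne_zero
  by_cases hK : K + 1 < n
  · rw [sum_rowWeight_row _ _ (by omega)]
    refine H.triangular_test HW hnN hu hus hK fun i hi => ?_
    rw [H.proj_blockScale, endWeight_eq_zero (Or.inl hi), zero_smul]
  · refine (H.window_test HW hnN (k := K + 1 - n)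
      (fun i hi => endWeight_eq_zero (by omega)) x).trans (Finset.sum_le_sum fun i _ => ?_)
    have hc : 1 ≤ s ^ 2 / (s ^ 2 - u ^ 2) := by
      rw [le_div_iff₀ (by linarith)]
      nlinarith [sq_nonneg u]
    split_ifs with hi
    · refine le_mul_of_one_le_left (sq_nonneg _) ?_
      rw [rowWeight]
      split_ifs
      · exact le_rfl
      · exact hc
      · omega
    · exact mul_nonneg (rowWeight_nonneg (by linarith) _ _) (sq_nonneg _)

theorem endWeight_energy [FiniteDimensional ℝ E] (H : BlockTridiag N P T (r * ρL) (r * ρU))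
    (hr : 0 < r) (hL : 0 ≤ ρL) (hU : 0 ≤ ρU) (hs : ρL + ρU = 1) {ν s ε t : ℝ} {x : E}
    (hx : ‖x‖ = 1) (hTx : ‖T x‖ = ν) (HW : WindowBound N n P T s) (hnN : n ≤ N) (hn : 2 ≤ n)
    (hε : 0 < ε) (hus : r * ρU < s) {c w d S e : ℝ}
    (hc : c = s ^ 2 / (s ^ 2 - (r * ρU) ^ 2)) (hw : w = halfSine t n (n - 1))
    (hd : d = halfSineStep t n (n - 1)) (hS : S = ∑ q ∈ Finset.range n, halfSine t n q ^ 2)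
    (he : e = ∑ q ∈ Finset.range n, halfSineStep t n q ^ 2) :
    ε * (s ^ 2 * S) ≤ (ν + ε) * (ε * (ν * (S + (c - 1) * w ^ 2))
      + r ^ 2 * (ρL * (e - d ^ 2) + 2 * c * ρL ^ 2 * d ^ 2
        + (ρU * e + 2 * c * ρU ^ 2 * w ^ 2))) := by
  have hu : 0 ≤ r * ρU := mul_nonneg hr.le hU
  have hlt : (r * ρU) ^ 2 < s ^ 2 := pow_lt_pow_left₀ hus hu two_ne_zero
  have hc0 : 0 ≤ c := hc ▸ div_nonneg (sq_nonneg s) (by linarith)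
  have hed : e - d ^ 2 = ∑ q ∈ Finset.range (n - 1), halfSineStep t n q ^ 2 := by
    have h1 := Finset.sum_range_succ (fun q => halfSineStep t n q ^ 2) (n - 1)
    rw [Nat.sub_add_cancel (by omega)] at h1
    rw [he, hd, h1, add_sub_cancel_right]
  refine H.amplified_windows_le hr hL hU hs hx hTx hε hc0 (M := N + n) (by omega)
    (W := endWeight t n) (fun K i h => endWeight_eq_zero (Or.inl h))
    (fun K _ => hc ▸ H.endWeight_test HW hnN hu hus K x) (fun i hi => ?_)
    (fun i => by rw [endWeight_self (by omega), hw]) (fun j => ?_) (fun j hj => ?_)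
    (fun j hj => ?_)
  · rw [hS, sum_endWeight_sq (by omega)]
  · rw [endWeight_succ_sub, if_pos (by omega), hd]
    congr 2
    omega
  · rw [hed, sum_endWeight_sub_sq_ite (a := j + 1) (b := n - 1) (by omega) (by omega) (by omega)]
  · rw [he, sum_endWeight_sub_sq_ite (b := n) (by omega) rfl (by omega)]

end BlockTridiag

end

lemma edge_poly_small {p : ℝ} (h0 : 0 ≤ p) (h1 : p ≤ 1 / 6) :
    4 * (1 + 6 * p) * (1 - 2 * p - 2 * p ^ 2 + 4 / 3 * p ^ 3 + 5 / 6 * p ^ 4)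
      ≤ (5 - 125 / 6 * p ^ 2) * (1 + p - p ^ 2 - 2 / 3 * p ^ 3) := by
  have h2 : 0 ≤ 1 - 6 * p := by linarith
  nlinarith [mul_nonneg h0 h2, mul_nonneg (mul_nonneg h0 h0) h2, mul_nonneg (mul_nonneg h0 h2) h2,
    pow_nonneg h0 3, pow_nonneg h0 4, pow_nonneg h0 5, mul_nonneg (pow_nonneg h0 3) h2,
    mul_nonneg (pow_nonneg h0 4) h2, sq_nonneg (p - 1 / 7), mul_nonneg h0 (sq_nonneg (p - 1 / 7))]

lemma edge_poly_large {p : ℝ} (h0 : 1 / 6 ≤ p) (h1 : p ≤ 0.2618) :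
    4 * (1 + 1) * (1 - 2 * p - 2 * p ^ 2 + 4 / 3 * p ^ 3 + 5 / 6 * p ^ 4)
      ≤ (5 - 125 / 6 * p ^ 2) * (1 + p - p ^ 2 - 2 / 3 * p ^ 3) := by
  have h2 : 0 ≤ p - 1 / 6 := by linarith
  have h3 : 0 ≤ 0.2618 - p := by linarith
  have h4 : 0 ≤ p := by linarith
  nlinarith [mul_nonneg h2 h3, mul_nonneg (mul_nonneg h2 h3) h4, pow_nonneg h4 3, pow_nonneg h4 5,
    mul_nonneg (mul_nonneg h2 h3) (sq_nonneg p), mul_nonneg (mul_nonneg h2 h3) (pow_nonneg h4 3)]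

lemma edge_trig {p : ℝ} (h0 : 0 ≤ p) (h1 : p ≤ π / 12) :
    4 * Real.sin p * (1 + Real.sin (6 * p)) * (Real.cos (2 * p) - Real.sin (2 * p))
      ≤ Real.sin (5 * p) * (Real.cos p * (Real.cos p + Real.sin p)) := by
  have hp : p ≤ 0.2618 := by linarith [Real.pi_lt_d4]
  have hcs : Real.cos (2 * p) - Real.sin (2 * p)
      ≤ 1 - 2 * p - 2 * p ^ 2 + 4 / 3 * p ^ 3 + 5 / 6 * p ^ 4 := by
    have h2 := (abs_sub_le_iff.1 (Real.cos_bound (x := 2 * p)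
      (by rw [abs_of_nonneg (by linarith)]; linarith))).1
    rw [abs_of_nonneg (by linarith)] at h2
    have h3 := Real.sin_ge_sub_cube (x := 2 * p) (by linarith)
    nlinarith
  have hcs0 : 0 ≤ 1 - 2 * p - 2 * p ^ 2 + 4 / 3 * p ^ 3 + 5 / 6 * p ^ 4 := by
    nlinarith [pow_nonneg h0 3, pow_nonneg h0 4]
  have hright : 1 + p - p ^ 2 - 2 / 3 * p ^ 3 ≤ Real.cos p * (Real.cos p + Real.sin p) := by
    have h2 := Real.one_sub_sq_div_two_le_cos (x := 2 * p)
    have h3 := Real.sin_ge_sub_cube (x := 2 * p) (by linarith)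
    rw [Real.cos_two_mul] at h2
    rw [Real.sin_two_mul] at h3
    nlinarith
  have hright0 : 0 ≤ 1 + p - p ^ 2 - 2 / 3 * p ^ 3 := by nlinarith [pow_nonneg h0 3]
  have h5 : p * (5 - 125 / 6 * p ^ 2) ≤ Real.sin (5 * p) := by
    have := Real.sin_ge_sub_cube (x := 5 * p) (by linarith)
    nlinarith
  have h50 : 0 ≤ 5 - 125 / 6 * p ^ 2 := by nlinarith
  have hs0 : 0 ≤ Real.sin p := Real.sin_nonneg_of_nonneg_of_le_pi h0 (by linarith [Real.pi_pos])
  have h6 : 0 ≤ 1 + Real.sin (6 * p) := by linarith [Real.neg_one_le_sin (6 * p)]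
  have hmin : ∃ m, Real.sin (6 * p) ≤ m ∧ 0 ≤ m
      ∧ 4 * (1 + m) * (1 - 2 * p - 2 * p ^ 2 + 4 / 3 * p ^ 3 + 5 / 6 * p ^ 4)
        ≤ (5 - 125 / 6 * p ^ 2) * (1 + p - p ^ 2 - 2 / 3 * p ^ 3) := by
    rcases le_total p (1 / 6) with h | h
    · exact ⟨6 * p, Real.sin_le (by linarith), by linarith, edge_poly_small h0 h⟩
    · exact ⟨1, Real.sin_le_one _, zero_le_one, edge_poly_large h hp⟩
  obtain ⟨m, hm, hm0, hpoly⟩ := hmin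
  calc 4 * Real.sin p * (1 + Real.sin (6 * p)) * (Real.cos (2 * p) - Real.sin (2 * p))
      ≤ 4 * Real.sin p * (1 + Real.sin (6 * p))
        * (1 - 2 * p - 2 * p ^ 2 + 4 / 3 * p ^ 3 + 5 / 6 * p ^ 4) :=
        mul_le_mul_of_nonneg_left hcs (by positivity)
    _ ≤ 4 * p * (1 + m) * (1 - 2 * p - 2 * p ^ 2 + 4 / 3 * p ^ 3 + 5 / 6 * p ^ 4) := by
        have := Real.sin_le h0
        gcongr
    _ = p * (4 * (1 + m) * (1 - 2 * p - 2 * p ^ 2 + 4 / 3 * p ^ 3 + 5 / 6 * p ^ 4)) := by ring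
    _ ≤ p * ((5 - 125 / 6 * p ^ 2) * (1 + p - p ^ 2 - 2 / 3 * p ^ 3)) :=
        mul_le_mul_of_nonneg_left hpoly h0
    _ = p * (5 - 125 / 6 * p ^ 2) * (1 + p - p ^ 2 - 2 / 3 * p ^ 3) := by ring
    _ ≤ _ := mul_le_mul h5 hright hright0 ((mul_nonneg h0 h50).trans h5)

lemma edge_base {t : ℝ} (h0 : 0 ≤ t) (h1 : t ≤ π / 6) :
    8 * Real.sin (t / 2) * Real.cos (π / 4 + t) * Real.sin (π / 4 + 3 * t / 2) ^ 2
      ≤ Real.sin (π / 4 + t / 2)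
        * (Real.sin (π / 4 + 3 * t / 2) ^ 2 - Real.cos (π / 4 + t) ^ 2) := by
  have key := edge_trig (p := t / 2) (by linarith) (by linarith)
  have e1 : Real.sin (π / 4 + 3 * t / 2) ^ 2 = (1 + Real.sin (6 * (t / 2))) / 2 := by
    rw [Real.sin_sq_eq_half_sub, show 2 * (π / 4 + 3 * t / 2) = 6 * (t / 2) + π / 2 by ring,
      Real.cos_add_pi_div_two]
    ring
  have e2 : Real.cos (π / 4 + t) ^ 2 = (1 - Real.sin (2 * t)) / 2 := by
    rw [Real.cos_sq, show 2 * (π / 4 + t) = 2 * t + π / 2 by ring, Real.cos_add_pi_div_two]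
    ring
  have e3 : Real.sin (6 * (t / 2)) + Real.sin (2 * t)
      = 2 * (Real.sin (5 * (t / 2)) * Real.cos (t / 2)) := by
    rw [show 6 * (t / 2) = 5 * (t / 2) + t / 2 by ring, show 2 * t = 5 * (t / 2) - t / 2 by ring,
      Real.sin_add, Real.sin_sub]
    ring
  have e4 : Real.cos (π / 4 + t)
      = √2 / 2 * (Real.cos (2 * (t / 2)) - Real.sin (2 * (t / 2))) := by
    rw [Real.cos_add, Real.cos_pi_div_four, Real.sin_pi_div_four,
      show 2 * (t / 2) = t by ring]
    ring
  have e5 : Real.sin (π / 4 + t / 2) = √2 / 2 * (Real.cos (t / 2) + Real.sin (t / 2)) := by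
    rw [Real.sin_add, Real.cos_pi_div_four, Real.sin_pi_div_four]
    ring
  have e6 : Real.sin (π / 4 + 3 * t / 2) ^ 2 - Real.cos (π / 4 + t) ^ 2
      = Real.sin (5 * (t / 2)) * Real.cos (t / 2) := by
    rw [e1, e2]; linarith
  rw [e6, e1, e4, e5]
  have := mul_le_mul_of_nonneg_left key (by positivity : 0 ≤ √2 / 2)
  linarith

/-- Comparison of the last two half-sine values with the slope at the end of the support. -/
lemma edge_bound {x t : ℝ} (h0 : 0 ≤ t) (hx0 : π / 2 ≤ x - t / 2) (hx1 : x + t ≤ 3 * π / 4) :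
    8 * Real.sin (t / 2) * -Real.cos x * Real.sin (x - t / 2) ^ 2
      ≤ Real.sin (x + t / 2) * (Real.sin (x - t / 2) ^ 2 - Real.cos x ^ 2) := by
  have ht : t ≤ π / 6 := by linarith
  have base := edge_base h0 ht
  have hpi := Real.pi_pos
  have ec : -Real.cos x = Real.cos (π - x) := (Real.cos_pi_sub x).symm
  have eb : Real.sin (x - t / 2) = Real.sin (π - x + t / 2) := by
    rw [← Real.sin_pi_sub]; congr 1; ring
  have ew : Real.sin (x + t / 2) = Real.sin (π - x - t / 2) := by
    rw [← Real.sin_pi_sub]; congr 1; ring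
  have hc0 : 0 ≤ Real.cos (π - x) := Real.cos_nonneg_of_mem_Icc ⟨by linarith, by linarith⟩
  have hc : Real.cos (π - x) ≤ Real.cos (π / 4 + t) :=
    Real.cos_le_cos_of_nonneg_of_le_pi (by linarith) (by linarith) (by linarith)
  have hb : Real.sin (π / 4 + 3 * t / 2) ≤ Real.sin (π - x + t / 2) :=
    Real.sin_le_sin_of_le_of_le_pi_div_two (by linarith) (by linarith) (by linarith)
  have hw : Real.sin (π / 4 + t / 2) ≤ Real.sin (π - x - t / 2) :=
    Real.sin_le_sin_of_le_of_le_pi_div_two (by linarith) (by linarith) (by linarith)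
  have hb0 : 0 < Real.sin (π / 4 + 3 * t / 2) :=
    Real.sin_pos_of_pos_of_lt_pi (by linarith) (by linarith)
  have hw0 : 0 ≤ Real.sin (π / 4 + t / 2) :=
    Real.sin_nonneg_of_nonneg_of_le_pi (by linarith) (by linarith)
  have hh : 0 ≤ Real.sin (t / 2) := Real.sin_nonneg_of_nonneg_of_le_pi (by linarith) (by linarith)
  have hcb0 : Real.cos (π - x) ≤ Real.sin (π - x + t / 2) := by
    rw [← Real.sin_pi_div_two_sub]
    exact Real.sin_le_sin_of_le_of_le_pi_div_two (by linarith) (by linarith) (by linarith)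
  have ec2 : Real.cos x ^ 2 = Real.cos (π - x) ^ 2 := by rw [← ec, neg_sq]
  rw [ec2, ec, eb, ew]
  generalize Real.cos (π - x) = c at *
  generalize Real.sin (π - x + t / 2) = b at *
  generalize Real.sin (π - x - t / 2) = w at *
  generalize Real.cos (π / 4 + t) = c₁ at *
  generalize Real.sin (π / 4 + 3 * t / 2) = b₁ at *
  generalize Real.sin (π / 4 + t / 2) = w₁ at *
  generalize Real.sin (t / 2) = h at *
  have hcb : c * b₁ ≤ c₁ * b := mul_le_mul hc hb hb0.le (hc0.trans hc)
  have hcb2 : c ^ 2 * b₁ ^ 2 ≤ c₁ ^ 2 * b ^ 2 := by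
    have := pow_le_pow_left₀ (mul_nonneg hc0 hb0.le) hcb 2
    rwa [mul_pow, mul_pow] at this
  refine le_of_mul_le_mul_right ?_ (pow_pos hb0 2)
  calc 8 * h * c * b ^ 2 * b₁ ^ 2 ≤ 8 * h * c₁ * b ^ 2 * b₁ ^ 2 := by gcongr
    _ = 8 * h * c₁ * b₁ ^ 2 * b ^ 2 := by ring
    _ ≤ w₁ * (b₁ ^ 2 - c₁ ^ 2) * b ^ 2 := mul_le_mul_of_nonneg_right base (sq_nonneg b)
    _ = w₁ * (b ^ 2 * b₁ ^ 2 - c₁ ^ 2 * b ^ 2) := by ring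
    _ ≤ w₁ * (b ^ 2 * b₁ ^ 2 - c ^ 2 * b₁ ^ 2) :=
      mul_le_mul_of_nonneg_left (by linarith) hw0
    _ ≤ w * (b ^ 2 * b₁ ^ 2 - c ^ 2 * b₁ ^ 2) := by
      refine mul_le_mul_of_nonneg_right hw ?_
      rw [← sub_mul]
      exact mul_nonneg (sub_nonneg.2 (pow_le_pow_left₀ hc0 hcb0 2)) (sq_nonneg _)
    _ = w * (b ^ 2 - c ^ 2) * b₁ ^ 2 := by ring

section

lemma amplified_energy_le {r h ν s c b w g ρL ρU e S d2 κ : ℝ} (hr : 0 < r) (hh : 0 < h)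
    (hν : 0 ≤ ν) (hsν : ν + 2 * r * h < s) (hL : 0 ≤ ρL) (hU : 0 ≤ ρU) (hs : ρL + ρU = 1)
    (hc : 0 ≤ c) (hc2 : c ^ 2 ≤ 1 / 2) (hcb : c < b) (hw : 0 ≤ w) (hwb : w ≤ b)
    (hUb : ρU * b ≤ 2 * h * c) (hcg : c ≤ g)
    (hedge : 8 * h * c * b ^ 2 ≤ w * (b ^ 2 - c ^ 2))
    (he : e = 4 * h ^ 2 * S - h ^ 2 - 2 * h * w * g) (hd2 : d2 = 4 * h ^ 2 * c ^ 2)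
    (hκ : κ = s ^ 2 / (s ^ 2 - (r * ρU) ^ 2)) :
    2 * r * h * (ν * (S + (κ - 1) * w ^ 2))
      + r ^ 2 * (ρL * (e - d2) + 2 * κ * ρL ^ 2 * d2 + (ρU * e + 2 * κ * ρU ^ 2 * w ^ 2))
      ≤ 2 * r * h * ((ν + 2 * r * h) * S) := by
  have hb : 0 < b := hc.trans_lt hcb
  have hε : 0 < 2 * r * h := by positivity
  have hub : r * ρU * b ≤ 2 * r * h * c := by
    linarith [mul_le_mul_of_nonneg_left hUb hr.le]
  have hub2 : (r * ρU) ^ 2 * b ^ 2 ≤ (2 * r * h) ^ 2 * c ^ 2 := by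
    have := pow_le_pow_left₀ (by positivity) hub 2
    rwa [mul_pow, mul_pow (2 * r * h)] at this
  have hu : r * ρU ≤ 2 * r * h := by
    refine le_of_mul_le_mul_right (hub.trans ?_) hb
    exact mul_le_mul_of_nonneg_left hcb.le hε.le
  have hu2 : (r * ρU) ^ 2 ≤ (2 * r * h) ^ 2 := pow_le_pow_left₀ (by positivity) hu 2
  have hs2 : (ν + 2 * r * h) ^ 2 < s ^ 2 := pow_lt_pow_left₀ hsν (by positivity) two_ne_zero
  have hgap : 2 * (2 * r * h) * ν ≤ s ^ 2 - (r * ρU) ^ 2 := by linarith [sq_nonneg ν]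
  have hpos : 0 < s ^ 2 - (r * ρU) ^ 2 := by linarith [mul_nonneg hν hε.le, sq_nonneg ν]
  have hκ1 : 2 * r * h * ν * (κ - 1) ≤ (r * ρU) ^ 2 / 2 := by
    have : κ - 1 = (r * ρU) ^ 2 / (s ^ 2 - (r * ρU) ^ 2) := by
      rw [hκ, eq_div_iff hpos.ne', sub_mul, div_mul_cancel₀ _ hpos.ne']; ring
    rw [this, ← mul_div_assoc, div_le_iff₀ hpos]
    linarith [mul_le_mul_of_nonneg_left hgap (sq_nonneg (r * ρU))]
  have hκb : κ * (b ^ 2 - c ^ 2) ≤ b ^ 2 := by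
    rw [hκ, div_mul_eq_mul_div, div_le_iff₀ hpos]
    have h1 : (2 * r * h) ^ 2 ≤ s ^ 2 := by linarith [mul_nonneg hν hε.le, sq_nonneg ν]
    linarith [mul_le_mul_of_nonneg_right h1 (sq_nonneg c)]
  have hκ0 : 0 ≤ κ := hκ ▸ div_nonneg (sq_nonneg s) hpos.le
  have hUw : (ρU * w) ^ 2 ≤ (2 * h * c) ^ 2 :=
    pow_le_pow_left₀ (by positivity) ((mul_le_mul_of_nonneg_left hwb hU).trans hUb) 2
  have hfirst : 2 * r * h * ν * (κ - 1) * w ^ 2 ≤ r ^ 2 * h ^ 2 := by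
    have h1 := mul_le_mul_of_nonneg_right hκ1 (sq_nonneg w)
    have h2 := mul_le_mul_of_nonneg_left hUw (sq_nonneg r)
    have h3 := mul_le_mul_of_nonneg_left hc2 (by positivity : 0 ≤ 2 * r ^ 2 * h ^ 2)
    linarith
  have hbc : 0 < b ^ 2 - c ^ 2 :=
    sub_pos.2 (pow_lt_pow_left₀ hcb hc two_ne_zero)
  have hsecond : 16 * κ * h ^ 2 * c ^ 2 ≤ 2 * h * c * w := by
    refine le_of_mul_le_mul_right ?_ hbc
    have h1 := mul_le_mul_of_nonneg_left hκb (by positivity : 0 ≤ 16 * h ^ 2 * c ^ 2)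
    have h2 := mul_le_mul_of_nonneg_left hedge (by positivity : 0 ≤ 2 * h * c)
    linarith
  have hthird : 2 * κ * ρL ^ 2 * d2 + 2 * κ * ρU ^ 2 * w ^ 2 ≤ 2 * h * w * g := by
    have hL2 : ρL ^ 2 ≤ 1 := pow_le_one₀ hL (by linarith)
    have h1 := mul_le_mul_of_nonneg_left hL2 (by positivity : 0 ≤ 8 * κ * h ^ 2 * c ^ 2)
    have h2 := mul_le_mul_of_nonneg_left hUw (by positivity : 0 ≤ 2 * κ)
    have h3 := mul_le_mul_of_nonneg_left hcg (by positivity : 0 ≤ 2 * h * w)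
    rw [hd2]
    linarith
  have hd : 0 ≤ ρL * d2 := by rw [hd2]; positivity
  have hZ : ρL * (e - d2) + 2 * κ * ρL ^ 2 * d2 + (ρU * e + 2 * κ * ρU ^ 2 * w ^ 2)
      ≤ 4 * h ^ 2 * S - h ^ 2 := by
    have : ρL * e + ρU * e = e := by rw [← add_mul, hs, one_mul]
    linarith
  have := mul_le_mul_of_nonneg_left hZ (sq_nonneg r)
  linarith

lemma half_sin_le_of_critical {ρL ρU x t : ℝ} (hL : 1 / 2 ≤ ρL) (hU : 0 ≤ ρU)
    (hs : ρL + ρU = 1) (ht0 : 0 < t) (ht : t ≤ π / 3) (hx0 : π / 2 ≤ x - t / 2)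
    (hx1 : x + t ≤ 3 * π / 4)
    (heq : Real.sin x - Real.sin (x - t) + ρL * ρU * Real.sin (x - 2 * t) = 0) :
    Real.sin (x + t / 2) ≤ ρL * Real.sin (x - t / 2) := by
  have hpi := Real.pi_pos
  have hd := critical_diff_nonneg hL hU hs ht0 ht (by linarith) (by linarith) heq
  have h1 := critical_sin_le hL hU hs ht0 ht (by linarith) (by linarith) heq
  obtain ⟨r1, r2⟩ := critical_recurrence hs heq
  have hρ : 2 / 3 ≤ ρL := by
    have h2 : Real.sin (π / 4) ≤ Real.sin (x + t) := by
      rw [← Real.sin_pi_sub (x + t)]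
      exact Real.sin_le_sin_of_le_of_le_pi_div_two (by linarith) (by linarith) (by linarith)
    rw [Real.sin_pi_div_four] at h2
    have h3 : 4 / 3 ≤ √2 := Real.le_sqrt_of_sq_le (by norm_num)
    nlinarith [Real.sin_le_one x]
  have hcos : 0 < Real.cos (t / 2) := Real.cos_pos_of_mem_Ioo ⟨by linarith, by linarith⟩
  have e1 : 2 * (Real.cos (t / 2) * Real.sin (x + t / 2)) = Real.sin (x + t) + Real.sin x := by
    rw [show x + t = x + t / 2 + t / 2 by ring, show Real.sin x = Real.sin (x + t / 2 - t / 2) by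
      congr 1; ring, Real.sin_add (x + t / 2), Real.sin_sub (x + t / 2)]
    ring
  have e2 : 2 * (Real.cos (t / 2) * Real.sin (x - t / 2)) = Real.sin x + Real.sin (x - t) := by
    rw [show x - t = x - t / 2 - t / 2 by ring, show Real.sin x = Real.sin (x - t / 2 + t / 2) by
      congr 1; ring, Real.sin_add (x - t / 2), Real.sin_sub (x - t / 2)]
    ring
  have hle : 2 * ρU * Real.cos t - 1 + ρU ≤ 0 := by nlinarith [Real.cos_le_one t]
  refine le_of_mul_le_mul_left ?_ hcos
  nlinarith [mul_nonneg hd (neg_nonneg.2 hle)]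

variable {E : Type*} [NormedAddCommGroup E] [InnerProductSpace ℝ E]

namespace BlockTridiag

variable {N n : ℕ} {P : ℕ → E →ₗ[ℝ] E} {T : E →ₗ[ℝ] E} {r ρL ρU : ℝ}

theorem le_of_small_angle [FiniteDimensional ℝ E] (H : BlockTridiag N P T (r * ρL) (r * ρU))
    (hr : 0 < r) (hL : 1 / 2 ≤ ρL) (hU : 0 ≤ ρU) (hs : ρL + ρU = 1) {ν s t : ℝ} {x : E}
    (hx : ‖x‖ = 1) (hTx : ‖T x‖ = ν) (HW : WindowBound N n P T s)
    (hn3 : 3 ≤ n) (hnN : n ≤ N) (ht0 : 0 < t) (ht : t ≤ π / 3) (hn : n * t ≤ 3 * π / 4)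
    (hn1 : π / 2 ≤ (n - 1) * t - t / 2)
    (heq : Real.sin ((n - 1) * t) - Real.sin ((n - 1) * t - t)
      + ρL * ρU * Real.sin ((n - 1) * t - 2 * t) = 0) :
    s ≤ ν + 2 * r * Real.sin (t / 2) := by
  have hpi := Real.pi_pos
  have hν : 0 ≤ ν := hTx ▸ norm_nonneg _
  obtain ⟨m, rfl⟩ : ∃ m, n = m + 2 := ⟨n - 2, by omega⟩
  set y : ℝ := ((m + 2 : ℕ) - 1 : ℝ) * t with hy
  have hyt : ((m + 2 : ℕ) : ℝ) * t = y + t := by rw [hy]; ring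
  rw [hyt] at hn
  set h : ℝ := Real.sin (t / 2) with hh
  have hhpos : 0 < h := Real.sin_pos_of_pos_of_lt_pi (by linarith) (by linarith)
  have hw_eq : halfSine t (m + 2) (m + 2 - 1) = Real.sin (y + t / 2) := by
    rw [halfSine, if_pos (by omega), hy]
    congr 1
    push_cast [show m + 2 - 1 = m + 1 from rfl]
    ring
  have hd_eq : halfSineStep t (m + 2) (m + 2 - 1) = 2 * h * Real.cos y := by
    rw [show m + 2 - 1 = m + 1 from rfl, halfSineStep_succ (by omega), hy]
    congr 2
    push_cast
    ring
  have hgap := sum_halfSine_gap ht0 (by linarith) (Nat.succ_pos (m + 1))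
  rw [show ((m + 1).succ - 1 / 2 : ℝ) * t = y + t / 2 by rw [hy]; push_cast; ring,
    show ((m + 1).succ + 1 / 2 : ℝ) * t = y + t + t / 2 by rw [hy]; push_cast; ring] at hgap
  have hdiff : Real.sin (y + t / 2) - Real.sin (y + t + t / 2) = 2 * h * -Real.cos (y + t) := by
    have := sin_half_sub (y + t) t
    rw [show y + t - t / 2 = y + t / 2 by ring] at this
    linarith
  rw [hdiff] at hgap
  have hc0 : Real.cos y ≤ 0 :=
    Real.cos_nonpos_of_pi_div_two_le_of_le (by linarith) (by linarith)
  have hw0 : 0 ≤ Real.sin (y + t / 2) :=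
    Real.sin_nonneg_of_nonneg_of_le_pi (by linarith) (by linarith)
  have hbw := half_sin_le_of_critical hL hU hs ht0 ht hn1 hn heq
  have hb0 : 0 ≤ Real.sin (y - t / 2) :=
    Real.sin_nonneg_of_nonneg_of_le_pi (by linarith) (by linarith)
  have hwb : Real.sin (y + t / 2) ≤ Real.sin (y - t / 2) :=
    hbw.trans (mul_le_of_le_one_left hb0 (by linarith))
  have hbw2 := sin_half_sub y t
  have hcbnd : -Real.cos y < √2 / 2 := by
    rw [← Real.cos_pi_sub, ← Real.cos_pi_div_four]
    exact Real.cos_lt_cos_of_nonneg_of_le_pi (by linarith) (by linarith) (by linarith)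
  have hc2 : (-Real.cos y) ^ 2 ≤ 1 / 2 := by
    refine (pow_le_pow_left₀ (neg_nonneg.2 hc0) hcbnd.le 2).trans (le_of_eq ?_)
    rw [div_pow, Real.sq_sqrt zero_le_two]
    norm_num
  have hbbnd : √2 / 2 ≤ Real.sin (y - t / 2) := by
    rw [← Real.sin_pi_sub, ← Real.sin_pi_div_four]
    exact Real.sin_le_sin_of_le_of_le_pi_div_two (by linarith) (by linarith) (by linarith)
  have hcg : -Real.cos y ≤ -Real.cos (y + t) :=
    neg_le_neg (Real.cos_le_cos_of_nonneg_of_le_pi (by linarith) (by linarith) (by linarith))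
  have hUb : ρU * Real.sin (y - t / 2) ≤ 2 * h * -Real.cos y := by
    have : ρL * Real.sin (y - t / 2) + ρU * Real.sin (y - t / 2) = Real.sin (y - t / 2) := by
      rw [← add_mul, hs, one_mul]
    linarith
  by_contra hcon
  push Not at hcon
  have hus : r * ρU < s := by
    have h2 : ρU ≤ 2 * h := by
      have hbpos : 0 < Real.sin (y - t / 2) := lt_of_lt_of_le (by positivity) hbbnd
      refine le_of_mul_le_mul_right (hUb.trans ?_) hbpos
      exact mul_le_mul_of_nonneg_left (hcbnd.le.trans hbbnd) (by positivity)
    linarith [mul_le_mul_of_nonneg_left h2 hr.le]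
  have henergy := H.endWeight_energy hr (by linarith) hU hs hx hTx HW hnN (by omega)
    (by positivity : 0 < 2 * r * h) hus rfl hw_eq.symm hd_eq.symm rfl rfl
  have hscal := amplified_energy_le (c := -Real.cos y) (b := Real.sin (y - t / 2))
    (w := Real.sin (y + t / 2)) (g := -Real.cos (y + t))
    (S := ∑ q ∈ Finset.range (m + 2), halfSine t (m + 2) q ^ 2)
    (e := ∑ q ∈ Finset.range (m + 2), halfSineStep t (m + 2) q ^ 2)
    (d2 := (2 * h * Real.cos y) ^ 2)
    hr hhpos hν hcon (by linarith) hU hs (by linarith)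
    hc2
    (hcbnd.trans_le hbbnd) hw0 hwb hUb hcg
    (by rw [neg_sq]; exact edge_bound ht0.le hn1 hn)
    (by linarith) (by ring) rfl
  have hSpos : 0 < ∑ q ∈ Finset.range (m + 2), halfSine t (m + 2) q ^ 2 := by
    refine Finset.sum_pos' (fun _ _ => sq_nonneg _) ⟨0, by simp, ?_⟩
    rw [halfSine, if_pos (by omega)]
    have : 0 < Real.sin (((0 : ℕ) + 1 / 2 : ℝ) * t) :=
      Real.sin_pos_of_pos_of_lt_pi (by simp; linarith) (by simp; linarith)
    positivity
  have htot := henergy.trans (mul_le_mul_of_nonneg_left hscal (by positivity))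
  have hsq : (ν + 2 * r * h) ^ 2 < s ^ 2 := pow_lt_pow_left₀ hcon (by positivity) two_ne_zero
  linarith [mul_pos (mul_pos (by positivity : 0 < 2 * r * h) hSpos) (sub_pos.2 hsq)]

end BlockTridiag

end

section

variable {E : Type*} [NormedAddCommGroup E] [InnerProductSpace ℝ E]

/-- The projections listed in reverse order. -/
def reverseProj (N : ℕ) (P : ℕ → E →ₗ[ℝ] E) (i : ℕ) : E →ₗ[ℝ] E :=
  if i < N then P (N - 1 - i) else 0

lemma reverseProj_of_lt {N i : ℕ} (P : ℕ → E →ₗ[ℝ] E) (hi : i < N) :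
    reverseProj N P i = P (N - 1 - i) := if_pos hi

lemma reverseProj_of_le {N i : ℕ} (P : ℕ → E →ₗ[ℝ] E) (hi : N ≤ i) :
    reverseProj N P i = 0 := if_neg (not_lt.2 hi)

lemma WindowBound.reverse {N n : ℕ} {P : ℕ → E →ₗ[ℝ] E} {T : E →ₗ[ℝ] E} {s : ℝ}
    (HW : WindowBound N n P T s) (hP : ∀ i x, N ≤ i → P i x = 0) :
    WindowBound N n (reverseProj N P) T s := by
  intro k hk z hz
  refine (HW (N - n - k) (by omega) z fun i hi => ?_).trans (le_of_eq ?_)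
  · by_cases hiN : i < N
    · have := hz (N - 1 - i) (by omega)
      rwa [reverseProj_of_lt P (by omega), show N - 1 - (N - 1 - i) = i by omega] at this
    · exact hP i z (not_lt.1 hiN)
  · refine Finset.sum_nbij' (fun i => N - 1 - i) (fun i => N - 1 - i) ?_ ?_ ?_ ?_ ?_
    · intro i hi; simp at hi ⊢; omega
    · intro i hi; simp at hi ⊢; omega
    · intro i hi; simp at hi ⊢; omega
    · intro i hi; simp at hi ⊢; omega
    · intro i hi
      simp at hi
      rw [reverseProj_of_lt P (by omega), show N - 1 - (N - 1 - i) = i by omega]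

namespace BlockTridiag

variable {N n : ℕ} {P : ℕ → E →ₗ[ℝ] E} {T : E →ₗ[ℝ] E}

lemma reverse {l u : ℝ} (H : BlockTridiag N P T l u) (hu : 0 ≤ u) :
    BlockTridiag N (reverseProj N P) T u l where
  proj_self i x := by
    by_cases hi : i < N
    · rw [reverseProj_of_lt P hi, H.proj_self]
    · simp [reverseProj_of_le P (not_lt.1 hi)]
  proj_ne i j x hij := by
    by_cases hi : i < N
    · by_cases hj : j < N
      · rw [reverseProj_of_lt P hi, reverseProj_of_lt P hj, H.proj_ne _ _ _ (by omega)]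
      · simp [reverseProj_of_le P (not_lt.1 hj)]
    · simp [reverseProj_of_le P (not_lt.1 hi)]
  proj_ge i x hi := by simp [reverseProj_of_le P hi]
  sum_proj x := by
    conv_rhs => rw [← H.sum_proj x, ← Finset.sum_range_reflect]
    exact Finset.sum_congr rfl fun i hi => by rw [reverseProj_of_lt P (Finset.mem_range.1 hi)]
  symm i x y := by
    by_cases hi : i < N
    · rw [reverseProj_of_lt P hi, H.symm]
    · simp [reverseProj_of_le P (not_lt.1 hi)]
  tri i j x hij := by
    by_cases hi : i < N
    · by_cases hj : j < N
      · rw [reverseProj_of_lt P hi, reverseProj_of_lt P hj, H.tri _ _ _ (by omega)]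
      · simp [reverseProj_of_le P (not_lt.1 hj)]
    · simp [reverseProj_of_le P (not_lt.1 hi)]
  lower j x := by
    by_cases hj : j + 1 < N
    · have := H.upper (N - 1 - (j + 1)) x
      rw [show N - 1 - (j + 1) + 1 = N - 1 - j by omega] at this
      rwa [reverseProj_of_lt P hj, reverseProj_of_lt P (by omega)]
    · rw [reverseProj_of_le P (not_lt.1 hj)]
      simpa using mul_nonneg hu (norm_nonneg _)
  upper j x := by
    by_cases hj : j + 1 < N
    · have := H.lower (N - 1 - (j + 1)) x
      rw [show N - 1 - (j + 1) + 1 = N - 1 - j by omega] at this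
      rwa [reverseProj_of_lt P hj, reverseProj_of_lt P (by omega)]
    · simp [reverseProj_of_le P (not_lt.1 hj)]

variable {r ρL ρU : ℝ}

lemma le_of_critical_angle_of_half_le [FiniteDimensional ℝ E]
    (H : BlockTridiag N P T (r * ρL) (r * ρU))
    (hr : 0 < r) (hL : 1 / 2 ≤ ρL) (hU : 0 ≤ ρU) (hs : ρL + ρU = 1) {ν s t : ℝ} {x : E}
    (hx : ‖x‖ = 1) (hTx : ‖T x‖ = ν) (hmin : ∀ z, ν * ‖z‖ ≤ ‖T z‖)
    (HW : WindowBound N n P T s) (hn3 : 3 ≤ n) (hnN : n ≤ N)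
    (ht0 : π / 2 ≤ (n - 1) * t - t / 2) (ht1 : n * t ≤ π)
    (heq : Real.sin ((n - 1) * t) - Real.sin ((n - 1) * t - t)
      + ρL * ρU * Real.sin ((n - 1) * t - 2 * t) = 0) :
    s ≤ ν + 2 * r * Real.sin (t / 2) := by
  have hn : (3 : ℝ) ≤ n := by exact_mod_cast hn3
  have ht : 0 < t := by
    by_contra hcon
    nlinarith [Real.pi_pos, mul_nonneg (sub_nonneg.2 hn) (neg_nonneg.2 (not_lt.1 hcon))]
  have ht3 : t ≤ π / 3 := by nlinarith
  rcases le_total (n * t) (3 * π / 4) with h | h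
  · exact H.le_of_small_angle hr hL hU hs hx hTx HW hn3 hnN ht ht3 h ht0 heq
  · refine H.le_of_large_angle hr (by linarith) hU hs hx hTx hmin HW hn3 hnN ht ht3 h ht1 ?_
    have := critical_sin_half_le hL hU hs ht ht3 (by nlinarith) (by linarith) heq
    rwa [show ((n : ℝ) - 1) * t + 3 * t / 2 = (n + 1 / 2) * t by ring,
      show ((n : ℝ) - 1) * t + t / 2 = (n - 1 / 2) * t by ring] at this

theorem le_of_critical_angle [FiniteDimensional ℝ E]
    (H : BlockTridiag N P T (r * ρL) (r * ρU))
    (hr : 0 < r) (hL : 0 ≤ ρL) (hU : 0 ≤ ρU) (hs : ρL + ρU = 1) {ν s t : ℝ} {x : E}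
    (hx : ‖x‖ = 1) (hTx : ‖T x‖ = ν) (hmin : ∀ z, ν * ‖z‖ ≤ ‖T z‖)
    (HW : WindowBound N n P T s) (hn3 : 3 ≤ n) (hnN : n ≤ N)
    (ht0 : π / 2 ≤ (n - 1) * t - t / 2) (ht1 : n * t ≤ π)
    (heq : Real.sin ((n - 1) * t) - Real.sin ((n - 1) * t - t)
      + ρL * ρU * Real.sin ((n - 1) * t - 2 * t) = 0) :
    s ≤ ν + 2 * r * Real.sin (t / 2) := by
  rcases le_total (1 / 2) ρL with h | h
  · exact H.le_of_critical_angle_of_half_le hr h hU hs hx hTx hmin HW hn3 hnN ht0 ht1 heq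
  · refine (H.reverse (mul_nonneg hr.le hU)).le_of_critical_angle_of_half_le
      hr (by linarith) hL (by linarith) hx hTx hmin (HW.reverse H.proj_ge) hn3 hnN ht0 ht1 ?_
    rwa [mul_comm ρU]

end BlockTridiag

end

lemma two_sin_half_mul_cos (p t : ℝ) :
    2 * Real.sin (t / 2) * Real.cos ((p + 1 / 2) * t)
      = Real.sin ((p + 1) * t) - Real.sin (p * t) := by
  rw [Real.sin_sub_sin]
  ring_nf

lemma sin_sub_sin_two_mul_add_nonpos {c t : ℝ} (hc : c ≤ 1 / 4) (ht0 : 0 ≤ t)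
    (ht : t ≤ π / 3) :
    Real.sin t - Real.sin (2 * t) + c * Real.sin (3 * t) ≤ 0 := by
  have hx1 := Real.cos_le_one t
  have hx : 1 / 2 ≤ Real.cos t := by
    rw [← Real.cos_pi_div_three]
    exact Real.cos_le_cos_of_nonneg_of_le_pi ht0 (by linarith [Real.pi_pos]) ht
  have hs : 0 ≤ Real.sin t := Real.sin_nonneg_of_nonneg_of_le_pi ht0 (by linarith [Real.pi_pos])
  have e : Real.sin t - Real.sin (2 * t) + c * Real.sin (3 * t)
      = - (Real.sin t * (2 * Real.cos t - 1) * (1 - c * (2 * Real.cos t + 1))) := by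
    rw [Real.sin_two_mul, Real.sin_three_mul]
    linear_combination (-4 * c * Real.sin t) * Real.sin_sq_add_cos_sq t
  rw [e, neg_nonpos]
  exact mul_nonneg (mul_nonneg hs (by linarith)) (by nlinarith)

lemma theta_mem {c : ℝ} (hc0 : 0 ≤ c) (hc : c ≤ 1 / 4) {p : ℕ} (hp : 1 ≤ p) :
    theta c p ∈ {t : ℝ | t ∈ Set.Icc (π / (2 * (p : ℝ) + 1)) (π / ((p : ℝ) + 2)) ∧
      2 * Real.sin (t / 2) * Real.cos (((p : ℝ) + 1 / 2) * t)
        + c * Real.sin (((p : ℝ) - 1) * t) = 0} := by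
  have hp1 : (1 : ℝ) ≤ p := by exact_mod_cast hp
  have hpi := Real.pi_pos
  set f : ℝ → ℝ := fun t => 2 * Real.sin (t / 2) * Real.cos (((p : ℝ) + 1 / 2) * t)
        + c * Real.sin (((p : ℝ) - 1) * t) with hf
  have hfc : Continuous f := by fun_prop
  have hle : π / (2 * (p : ℝ) + 1) ≤ π / ((p : ℝ) + 2) :=
    div_le_div_of_nonneg_left hpi.le (by positivity) (by linarith)
  have hl : 0 ≤ f (π / (2 * (p : ℝ) + 1)) := by
    have e : ((p : ℝ) + 1 / 2) * (π / (2 * (p : ℝ) + 1)) = π / 2 := by field_simp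
    simp only [hf, e, Real.cos_pi_div_two, mul_zero, zero_add]
    refine mul_nonneg hc0 (Real.sin_nonneg_of_nonneg_of_le_pi ?_ ?_)
    · exact mul_nonneg (by linarith) (by positivity)
    · rw [← mul_div_assoc, div_le_iff₀ (by positivity)]
      nlinarith
  have hr : f (π / ((p : ℝ) + 2)) ≤ 0 := by
    set t := π / ((p : ℝ) + 2) with ht
    have hpt : (p + 2) * t = π := by rw [ht]; field_simp
    have ht3 : t ≤ π / 3 :=
      div_le_div_of_nonneg_left hpi.le (by positivity) (by linarith)
    have e1 : ((p : ℝ) + 1) * t = π - t := by linarith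
    have e2 : (p : ℝ) * t = π - 2 * t := by linarith
    have e3 : ((p : ℝ) - 1) * t = π - 3 * t := by linarith
    simp only [hf]
    rw [two_sin_half_mul_cos, e1, e2, e3, Real.sin_pi_sub, Real.sin_pi_sub, Real.sin_pi_sub]
    exact sin_sub_sin_two_mul_add_nonpos hc (by positivity) ht3
  obtain ⟨t, ht, hft⟩ := intermediate_value_Icc' hle hfc.continuousOn ⟨hr, hl⟩
  have hcl : IsClosed {t : ℝ | t ∈ Set.Icc (π / (2 * (p : ℝ) + 1)) (π / ((p : ℝ) + 2)) ∧ f t = 0} :=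
    isClosed_Icc.inter (isClosed_eq hfc continuous_const)
  exact hcl.csInf_mem ⟨t, ht, hft⟩ ⟨π / (2 * (p : ℝ) + 1), fun y hy => hy.1.1⟩

lemma theta_critical {c : ℝ} (hc0 : 0 ≤ c) (hc : c ≤ 1 / 4) {n : ℕ} (hn : 3 ≤ n) :
    π / 2 ≤ (n - 1) * theta c (n - 2) - theta c (n - 2) / 2 ∧ n * theta c (n - 2) ≤ π ∧
    Real.sin ((n - 1) * theta c (n - 2)) - Real.sin ((n - 1) * theta c (n - 2) - theta c (n - 2))
      + c * Real.sin ((n - 1) * theta c (n - 2) - 2 * theta c (n - 2)) = 0 := by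
  obtain ⟨⟨h1, h2⟩, h3⟩ := theta_mem hc0 hc (p := n - 2) (by omega)
  have hn3 : (3 : ℝ) ≤ n := by exact_mod_cast hn
  rw [Nat.cast_sub (by omega : 2 ≤ n), Nat.cast_ofNat] at h1 h2 h3
  generalize theta c (n - 2) = t at *
  rw [div_le_iff₀ (by linarith)] at h1
  rw [le_div_iff₀ (by linarith)] at h2
  refine ⟨by linarith, by linarith, ?_⟩
  rw [two_sin_half_mul_cos] at h3
  rw [← h3]
  ring_nf

section SingularValues

variable {ι κ : Type*} [Fintype ι] [Fintype κ] [DecidableEq κ] (F : Matrix ι κ ℂ)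

lemma sval_nonneg : 0 ≤ sval F :=
  Real.sInf_nonneg fun _ ⟨_, _, hy⟩ => hy ▸ norm_nonneg _

lemma opNorm_nonneg : 0 ≤ opNorm F :=
  Real.sSup_nonneg fun _ ⟨_, _, hy⟩ => hy ▸ norm_nonneg _

lemma norm_toEuclideanLin_normalize {x : EuclideanSpace ℂ κ} (hx : x ≠ 0) :
    ∃ u : EuclideanSpace ℂ κ, ‖u‖ = 1 ∧
      ‖Matrix.toEuclideanLin F x‖ = ‖Matrix.toEuclideanLin F u‖ * ‖x‖ := by
  have hx' : ‖x‖ ≠ 0 := norm_ne_zero_iff.2 hx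
  refine ⟨((‖x‖⁻¹ : ℝ) : ℂ) • x, ?_, ?_⟩
  · rw [norm_smul, Complex.norm_real, norm_inv, norm_norm, inv_mul_cancel₀ hx']
  · rw [map_smul, norm_smul, Complex.norm_real, norm_inv, norm_norm]
    field_simp

lemma sval_mul_norm_le (x : EuclideanSpace ℂ κ) :
    sval F * ‖x‖ ≤ ‖Matrix.toEuclideanLin F x‖ := by
  rcases eq_or_ne x 0 with rfl | hx
  · simp
  obtain ⟨u, hu, e⟩ := norm_toEuclideanLin_normalize F hx
  rw [e]
  gcongr
  exact csInf_le ⟨0, fun _ ⟨_, _, hy⟩ => hy ▸ norm_nonneg _⟩ ⟨u, hu, rfl⟩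

lemma norm_toEuclideanLin_le_opNorm (x : EuclideanSpace ℂ κ) :
    ‖Matrix.toEuclideanLin F x‖ ≤ opNorm F * ‖x‖ := by
  rcases eq_or_ne x 0 with rfl | hx
  · simp
  obtain ⟨u, hu, e⟩ := norm_toEuclideanLin_normalize F hx
  rw [e]
  gcongr
  refine le_csSup ⟨‖(Matrix.toEuclideanLin F).toContinuousLinearMap‖, ?_⟩ ⟨u, hu, rfl⟩
  rintro _ ⟨v, hv, rfl⟩
  simpa [hv] using (Matrix.toEuclideanLin F).toContinuousLinearMap.le_opNorm v

lemma exists_norm_toEuclideanLin_eq_sval [Nonempty κ] :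
    ∃ x : EuclideanSpace ℂ κ, ‖x‖ = 1 ∧ ‖Matrix.toEuclideanLin F x‖ = sval F := by
  have hc : Continuous fun x => ‖Matrix.toEuclideanLin F x‖ :=
    (LinearMap.continuous_of_finiteDimensional _).norm
  have hne : (Metric.sphere (0 : EuclideanSpace ℂ κ) 1).Nonempty :=
    NormedSpace.sphere_nonempty.2 zero_le_one
  obtain ⟨x, hx, hmin⟩ := (isCompact_sphere _ _).exists_isMinOn hne hc.continuousOn
  have hx1 : ‖x‖ = 1 := by simpa using hx
  refine ⟨x, hx1, le_antisymm ?_ (by simpa [hx1] using sval_mul_norm_le F x)⟩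
  refine le_csInf ⟨_, x, hx1, rfl⟩ ?_
  rintro _ ⟨y, hy, rfl⟩
  exact hmin (by simpa using hy)

end SingularValues

section Blocks

variable {N : ℕ} {m : Fin N → ℕ} (a : ∀ i j : Fin N, Matrix (Fin (m i)) (Fin (m j)) ℂ)

lemma rL_nonneg : 0 ≤ rL a :=
  Real.sSup_nonneg fun _ ⟨_, _, _, hy⟩ => hy ▸ opNorm_nonneg _

lemma rU_nonneg : 0 ≤ rU a :=
  Real.sSup_nonneg fun _ ⟨_, _, _, hy⟩ => hy ▸ opNorm_nonneg _

lemma bddAbove_opNorm_blocks (p : Fin N → Fin N → Prop) :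
    BddAbove {y : ℝ | ∃ i j : Fin N, p i j ∧ y = opNorm (a i j)} := by
  refine ((Set.finite_range fun q : Fin N × Fin N => opNorm (a q.1 q.2)).subset ?_).bddAbove
  rintro _ ⟨i, j, -, rfl⟩
  exact ⟨(i, j), rfl⟩

lemma opNorm_le_rL {i j : Fin N} (h : (j : ℕ) + 1 = i) : opNorm (a i j) ≤ rL a :=
  le_csSup (bddAbove_opNorm_blocks a _) ⟨i, j, h, rfl⟩

lemma opNorm_le_rU {i j : Fin N} (h : (i : ℕ) + 1 = j) : opNorm (a i j) ≤ rU a :=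
  le_csSup (bddAbove_opNorm_blocks a _) ⟨i, j, h, rfl⟩

variable (m) in
/-- The coordinate projection onto the block with number `i` (zero if there is none). -/
def blockProj (i : ℕ) : EuclideanSpace ℂ ((i : Fin N) × Fin (m i)) →ₗ[ℝ]
    EuclideanSpace ℂ ((i : Fin N) × Fin (m i)) where
  toFun x := WithLp.toLp 2 fun q => if (q.1 : ℕ) = i then x q else 0
  map_add' x y := by
    ext q
    by_cases h : (q.1 : ℕ) = i <;> simp [h]
  map_smul' c x := by
    ext q
    by_cases h : (q.1 : ℕ) = i <;> simp [h]

lemma blockProj_apply (i : ℕ) (x : EuclideanSpace ℂ ((i : Fin N) × Fin (m i)))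
    (q : (i : Fin N) × Fin (m i)) :
    blockProj m i x q = if (q.1 : ℕ) = i then x q else 0 := rfl

/-- The `i`-th block of a vector. -/
def blockVec (x : EuclideanSpace ℂ ((i : Fin N) × Fin (m i))) (i : Fin N) :
    EuclideanSpace ℂ (Fin (m i)) :=
  WithLp.toLp 2 fun q => x ⟨i, q⟩

lemma norm_blockProj (x : EuclideanSpace ℂ ((i : Fin N) × Fin (m i))) (i : Fin N) :
    ‖blockProj m i x‖ = ‖blockVec x i‖ := by
  rw [EuclideanSpace.norm_eq, EuclideanSpace.norm_eq, Fintype.sum_sigma,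
    Finset.sum_eq_single_of_mem i (Finset.mem_univ _)]
  · simp [blockProj_apply, blockVec]
  · intro j _ hj
    simp [blockProj_apply, Fin.val_inj, hj]

/-- The real-linear map of a complex block matrix. -/
def blockMap : EuclideanSpace ℂ ((i : Fin N) × Fin (m i)) →ₗ[ℝ]
    EuclideanSpace ℂ ((i : Fin N) × Fin (m i)) :=
  (Matrix.toEuclideanLin (blockMat m a)).restrictScalars ℝ

lemma blockMap_apply (x : EuclideanSpace ℂ ((i : Fin N) × Fin (m i)))
    (i : Fin N) (p : Fin (m i)) :
    blockMap a x ⟨i, p⟩ = ∑ j, ∑ q, a i j p q * x ⟨j, q⟩ :=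
  Fintype.sum_sigma _

lemma blockVec_blockMap_blockProj (x : EuclideanSpace ℂ ((i : Fin N) × Fin (m i)))
    (i j : Fin N) :
    blockVec (blockMap a (blockProj m j x)) i = Matrix.toEuclideanLin (a i j) (blockVec x j) := by
  ext p
  refine (blockMap_apply a _ i p).trans ?_
  rw [Finset.sum_eq_single_of_mem j (Finset.mem_univ _)]
  · simp only [blockProj_apply, if_true]
    rfl
  · intro j' _ hj
    simp [blockProj_apply, Fin.val_inj, hj]

lemma norm_blockProj_blockMap_le (x : EuclideanSpace ℂ ((i : Fin N) × Fin (m i)))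
    (i j : Fin N) :
    ‖blockProj m i (blockMap a (blockProj m j x))‖ ≤ opNorm (a i j) * ‖blockProj m j x‖ := by
  rw [norm_blockProj, norm_blockProj, blockVec_blockMap_blockProj]
  exact norm_toEuclideanLin_le_opNorm _ _

lemma blockProj_of_le {i : ℕ} (hi : N ≤ i) (x : EuclideanSpace ℂ ((i : Fin N) × Fin (m i))) :
    blockProj m i x = 0 := by
  ext q
  have := q.1.isLt
  simp [blockProj_apply, show (q.1 : ℕ) ≠ i by omega]

lemma blockTridiag_blockMap {l u : ℝ} (hl : rL a ≤ l) (hu : rU a ≤ u)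
    (htri : ∀ i j : Fin N, 1 < |(i : ℤ) - (j : ℤ)| → a i j = 0) :
    BlockTridiag N (blockProj m) (blockMap a) l u where
  proj_self i x := by
    ext q
    by_cases h : (q.1 : ℕ) = i <;> simp [blockProj_apply, h]
  proj_ne i j x hij := by
    ext q
    by_cases h : (q.1 : ℕ) = i <;> simp [blockProj_apply, h, hij]
  proj_ge i x hi := blockProj_of_le hi x
  sum_proj x := by
    ext q
    simp [blockProj_apply]
  symm i x y := by
    rw [PiLp.inner_apply, PiLp.inner_apply]
    refine Finset.sum_congr rfl fun q _ => ?_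
    by_cases h : (q.1 : ℕ) = i <;> simp [blockProj_apply, h]
  tri i j x hij := by
    by_cases hi : i < N
    swap
    · exact blockProj_of_le (not_lt.1 hi) _
    by_cases hj : j < N
    swap
    · rw [blockProj_of_le (not_lt.1 hj), map_zero, map_zero]
    have h := norm_blockProj (blockMap a (blockProj m j x)) ⟨i, hi⟩
    rw [blockVec_blockMap_blockProj a x ⟨i, hi⟩ ⟨j, hj⟩, htri, map_zero, LinearMap.zero_apply,
      norm_zero, norm_eq_zero] at h
    · exact h
    · rw [lt_abs]
      simp only
      omega
  lower j x := by
    by_cases hj : j + 1 < N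
    · refine (norm_blockProj_blockMap_le a x ⟨j + 1, hj⟩ ⟨j, by omega⟩).trans ?_
      gcongr
      exact (opNorm_le_rL a rfl).trans hl
    · rw [blockProj_of_le (not_lt.1 hj), norm_zero]
      exact mul_nonneg ((rL_nonneg a).trans hl) (norm_nonneg _)
  upper j x := by
    by_cases hj : j + 1 < N
    · refine (norm_blockProj_blockMap_le a x ⟨j, by omega⟩ ⟨j + 1, hj⟩).trans ?_
      gcongr
      exact (opNorm_le_rU a rfl).trans hu
    · rw [blockProj_of_le (not_lt.1 hj) x, map_zero, map_zero, norm_zero, mul_zero]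

lemma sum_widx {M : Type*} [AddCommMonoid M] {n k : ℕ} (h : k + n ≤ N) (g : Fin N → M)
    (hg : ∀ i : Fin N, (i : ℕ) < k ∨ k + n ≤ i → g i = 0) :
    ∑ i : Fin n, g (widx h i) = ∑ i, g i := by
  refine Fintype.sum_of_injective (widx h) (fun i j hij => ?_) _ _ (fun i hi => hg i ?_)
    fun _ => rfl
  · have := congrArg Fin.val hij
    simp only [widx] at this
    omega
  · by_contra! hc
    exact hi ⟨⟨i - k, by omega⟩, Fin.ext (by simp only [widx]; omega)⟩

/-- The restriction of a vector to a window of blocks. -/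
def windowVec {n k : ℕ} (h : k + n ≤ N) (x : EuclideanSpace ℂ ((i : Fin N) × Fin (m i))) :
    EuclideanSpace ℂ ((i : Fin n) × Fin (m (widx h i))) :=
  WithLp.toLp 2 fun q => x ⟨widx h q.1, q.2⟩

lemma norm_windowVec_sq {n k : ℕ} (h : k + n ≤ N)
    (x : EuclideanSpace ℂ ((i : Fin N) × Fin (m i))) :
    ‖windowVec h x‖ ^ 2 = ∑ i ∈ Finset.Ico k (k + n), ‖blockProj m i x‖ ^ 2 := by
  rw [EuclideanSpace.norm_sq_eq, Fintype.sum_sigma, Finset.sum_Ico_eq_sum_range,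
    Nat.add_sub_cancel_left, Finset.sum_range]
  refine Finset.sum_congr rfl fun i _ => ?_
  rw [← Fin.val_mk (n := N) (by omega : k + (i : ℕ) < N), norm_blockProj,
    EuclideanSpace.norm_sq_eq]
  rfl

lemma apply_eq_zero_of_blockProj {i : Fin N} {x : EuclideanSpace ℂ ((i : Fin N) × Fin (m i))}
    (hx : blockProj m i x = 0) (q : Fin (m i)) : x ⟨i, q⟩ = 0 := by
  have := blockProj_apply i x ⟨i, q⟩
  rw [hx, if_pos rfl] at this
  exact this.symm

lemma windowBound_blockMap {n : ℕ} {s : ℝ} (hs : 0 ≤ s)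
    (hw : ∀ k (h : k + n ≤ N), s ≤ sval (window a n k h)) :
    WindowBound N n (blockProj m) (blockMap a) s := by
  intro k h z hz
  have e1 : ‖z‖ = ‖windowVec h z‖ := by
    rw [EuclideanSpace.norm_eq, EuclideanSpace.norm_eq, Fintype.sum_sigma, Fintype.sum_sigma]
    refine congrArg _ (sum_widx h (fun i => ∑ q, ‖z ⟨i, q⟩‖ ^ 2) fun i hi => ?_).symm
    exact Finset.sum_eq_zero fun q _ => by simp [apply_eq_zero_of_blockProj (hz i hi)]
  have e2 : Matrix.toEuclideanLin (window a n k h) (windowVec h z)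
      = windowVec h (blockMap a z) := by
    ext ⟨i, p⟩
    refine (Fintype.sum_sigma _).trans (Eq.trans ?_ (blockMap_apply a z (widx h i) p).symm)
    refine sum_widx h (fun j => ∑ q, a (widx h i) j p q * z ⟨j, q⟩) fun j hj => ?_
    exact Finset.sum_eq_zero fun q _ => by simp [apply_eq_zero_of_blockProj (hz j hj)]
  rw [← norm_windowVec_sq h, ← e2, e1, ← mul_pow]
  gcongr
  refine le_trans ?_ (sval_mul_norm_le _ _)
  gcongr
  exact hw k h

end Blocks

end SpecIncl

open SpecIncl in
/-- **Theorem 4.1 (square truncations).** If A is block-tridiagonal (C = 0),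
then for 2 < n ≤ N−1, `min_{0≤k≤N−n} ν(A_{n,k}) ≤ ν(A) + ε_{n−2}(A)`. -/
theorem nu_square_truncations {N : ℕ} (hN : 1 < N) {m : Fin N → ℕ}
    (hm : ∀ i, 0 < m i)
    (a : ∀ i j : Fin N, Matrix (Fin (m i)) (Fin (m j)) ℂ)
    (htri : ∀ i j : Fin N, 1 < |(i : ℤ) - (j : ℤ)| → a i j = 0)
    (n : ℕ) (hn : 2 < n) (hnN : n ≤ N - 1) :
    (⨅ k : Fin (N - n + 1),
        sval (window a n k (by have := k.isLt; omega)))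
      ≤ sval (blockMat m a) + epsTau a (n - 2) := by
  have : Nonempty ((i : Fin N) × Fin (m i)) := ⟨⟨⟨0, by omega⟩, ⟨0, hm _⟩⟩⟩
  obtain ⟨x, hx, hTx⟩ := exists_norm_toEuclideanLin_eq_sval (blockMat m a)
  set s := ⨅ k : Fin (N - n + 1), sval (window a n k (by have := k.isLt; omega))
  have HW : WindowBound N n (blockProj m) (blockMap a) s := by
    refine windowBound_blockMap a (Real.iInf_nonneg fun _ => sval_nonneg _) fun k h => ?_
    exact ciInf_le ⟨0, Set.forall_mem_range.2 fun _ => sval_nonneg _⟩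
      (⟨k, by omega⟩ : Fin (N - n + 1))
  have key : ∀ {r ρL ρU : ℝ}, 0 < r → 0 ≤ ρL → 0 ≤ ρU → ρL + ρU = 1 →
      rL a ≤ r * ρL → rU a ≤ r * ρU →
      s ≤ sval (blockMat m a) + 2 * r * Real.sin (theta (ρL * ρU) (n - 2) / 2) := by
    intro r ρL ρU hr hL hU hsum hl hu
    obtain ⟨h1, h2, h3⟩ := theta_critical (mul_nonneg hL hU)
      (by nlinarith [sq_nonneg (ρL - ρU)] : ρL * ρU ≤ 1 / 4) (n := n) (by omega)
    exact (blockTridiag_blockMap a hl hu htri).le_of_critical_angle hr hL hU hsum hx hTx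
      (fun z => sval_mul_norm_le _ z) HW (by omega) (by omega) h1 h2 h3
  have hC := opNorm_nonneg (blockMat m (remPart a))
  have hL := rL_nonneg a
  have hU := rU_nonneg a
  have hA : 0 ≤ rA a := add_nonneg hL hU
  unfold epsTau
  rcases hA.eq_or_lt with h0 | hr
  · have h0' : rL a + rU a = 0 := h0.symm
    rw [← h0, mul_zero, zero_mul, zero_add]
    refine le_of_forall_pos_le_add fun δ hδ => ?_
    have h := key (r := δ / 2) (ρL := 1) (ρU := 0) (by positivity) zero_le_one le_rfl (by ring)
      (by linarith) (by linarith)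
    have := mul_le_mul_of_nonneg_left
      (Real.sin_le_one (theta (1 * 0) (n - 2) / 2)) (by positivity : 0 ≤ 2 * (δ / 2))
    linarith
  · have h := key (r := rA a) (ρL := rL a / rA a) (ρU := rU a / rA a) hr (by positivity)
      (by positivity) (by rw [← add_div]; exact div_self hr.ne')
      (by rw [mul_div_cancel₀ _ hr.ne']) (by rw [mul_div_cancel₀ _ hr.ne'])
    rw [div_mul_div_comm, ← sq] at h
    linarith
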